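/- arXiv:math/0011234 — 3 statements merged into one kernel-verified Lean document; each statement's English description precedes it below -/
import Mathlib

section
/- Let A and B be subcomplexes of a finite simplicial complex with A ∩ B nonempty, suppose |A| ≃ S^n ≃ |B| and |A ∩ B| ≃ S^r with r < n, and suppose both inclusion maps |A ∩ B| ↪ |A| and |A ∩ B| ↪ |B| are homotopic to constant maps. Then |A ∪ B| is homotopy equivalent to the wedge S^{r+1} ∨ S^n ∨ S^n. -/
open Finset

/-- A finite abstract simplicial complex: a collection of nonempty finite sets closed
under taking nonempty subsets. -/
def IsComplex {V : Type} (K : Finset (Finset V)) : Prop :=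
  ∀ s ∈ K, s.Nonempty ∧ ∀ t, t ⊆ s → t.Nonempty → t ∈ K

/-- Geometric realization of the finite abstract simplicial complex `K`, as a subspace of
`V → ℝ`: the convex combinations of vertices whose support is a face of `K`. -/
def realization {V : Type} [Fintype V] (K : Finset (Finset V)) : Set (V → ℝ) :=
  {x | (∀ v, 0 ≤ x v) ∧ (∑ v, x v) = 1 ∧ ∃ s ∈ K, ∀ v, x v ≠ 0 ↔ v ∈ s}

lemma realization_mono {V : Type} [Fintype V] {K L : Finset (Finset V)} (h : K ⊆ L) :
    realization K ⊆ realization L := by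
  rintro x ⟨h0, h1, s, hs, hsupp⟩
  exact ⟨h0, h1, s, h hs, hsupp⟩

/-- The inclusion map between geometric realizations induced by an inclusion of complexes. -/
def inclMap {V : Type} [Fintype V] {K L : Finset (Finset V)} (h : K ⊆ L) :
    C(↥(realization K), ↥(realization L)) :=
  ⟨Set.inclusion (realization_mono h), continuous_inclusion (realization_mono h)⟩

/-- The unreduced suspension of a topological space `X`: the quotient of `X × [0,1]`
collapsing `X × {0}` to a point and `X × {1}` to a point. -/
def Susp (X : Type) [TopologicalSpace X] : Type :=
  Quot fun p q : X × unitInterval => p.2 = q.2 ∧ (p.2 = 0 ∨ p.2 = 1)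

instance (X : Type) [TopologicalSpace X] : TopologicalSpace (Susp X) :=
  inferInstanceAs (TopologicalSpace (Quot _))

/-- The wedge (one-point union) of three pointed spaces: the disjoint union with the three
base points identified. -/
def Wedge3 (X Y Z : Type) [TopologicalSpace X] [TopologicalSpace Y] [TopologicalSpace Z]
    (x₀ : X) (y₀ : Y) (z₀ : Z) : Type :=
  Quot fun u v : X ⊕ Y ⊕ Z =>
    (u = Sum.inl x₀ ∧ v = Sum.inr (Sum.inl y₀)) ∨
    (u = Sum.inl x₀ ∧ v = Sum.inr (Sum.inr z₀))

instance (X Y Z : Type) [TopologicalSpace X] [TopologicalSpace Y] [TopologicalSpace Z]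
    (x₀ : X) (y₀ : Y) (z₀ : Z) : TopologicalSpace (Wedge3 X Y Z x₀ y₀ z₀) :=
  inferInstanceAs (TopologicalSpace (Quot _))

/-- The `k`-dimensional sphere, as a type. -/
noncomputable def NSphere (k : ℕ) : Type := ↥(Metric.sphere (0 : EuclideanSpace ℝ (Fin (k + 1))) 1)

noncomputable instance (k : ℕ) : TopologicalSpace (NSphere k) :=
  inferInstanceAs (TopologicalSpace ↥(Metric.sphere (0 : EuclideanSpace ℝ (Fin (k + 1))) 1))

open ContinuousMap unitInterval Topology

section HomotopyTheory

variable {X Y Z D E P Q : Type} [TopologicalSpace X] [TopologicalSpace Y] [TopologicalSpace Z]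
  [TopologicalSpace D] [TopologicalSpace E] [TopologicalSpace P] [TopologicalSpace Q]

/-- A continuous map that admits a homotopy inverse. -/
def IsHomotopyEquiv (f : C(X, Y)) : Prop :=
  ∃ g : C(Y, X), (g.comp f).Homotopic (.id X) ∧ (f.comp g).Homotopic (.id Y)

lemma IsHomotopyEquiv.nonempty {f : C(X, Y)} (hf : IsHomotopyEquiv f) :
    Nonempty (HomotopyEquiv X Y) :=
  let ⟨g, h₁, h₂⟩ := hf
  ⟨⟨f, g, h₁, h₂⟩⟩

lemma ContinuousMap.HomotopyEquiv.isHomotopyEquiv (e : HomotopyEquiv X Y) :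
    IsHomotopyEquiv e.toFun :=
  ⟨e.invFun, e.left_inv, e.right_inv⟩

lemma homotopic_comp_id {f : C(X, X)} (hf : f.Homotopic (.id X)) (g : C(X, Y)) :
    (g.comp f).Homotopic g := by
  simpa using (Homotopic.refl g).comp hf

lemma homotopic_id_comp {f : C(Y, Y)} (hf : f.Homotopic (.id Y)) (g : C(X, Y)) :
    (f.comp g).Homotopic g := by
  simpa using hf.comp (Homotopic.refl g)

lemma IsHomotopyEquiv.comp {g : C(Y, Z)} {f : C(X, Y)} (hg : IsHomotopyEquiv g)
    (hf : IsHomotopyEquiv f) : IsHomotopyEquiv (g.comp f) :=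
  let ⟨f', hf₁, hf₂⟩ := hf
  let ⟨g', hg₁, hg₂⟩ := hg
  ((ContinuousMap.HomotopyEquiv.mk f f' hf₁ hf₂).trans
    (ContinuousMap.HomotopyEquiv.mk g g' hg₁ hg₂)).isHomotopyEquiv

/-- A form of the two-out-of-six property for homotopy equivalences. -/
lemma IsHomotopyEquiv.of_comp_comp {f : C(X, Y)} {g : C(Y, Z)} {φ : C(Z, X)} {l : C(Z, Y)}
    (hφ : IsHomotopyEquiv φ) (h : (φ.comp (g.comp f)).Homotopic (.id X))
    (hl : (l.comp g).Homotopic (.id Y)) : IsHomotopyEquiv f := by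
  obtain ⟨ψ, h₁, h₂⟩ := hφ
  have hgf : (g.comp f).Homotopic ψ :=
    (homotopic_id_comp h₁ (g.comp f)).symm.trans (homotopic_comp_id h ψ)
  have hgfφ : (g.comp (f.comp φ)).Homotopic (.id Z) :=
    (hgf.comp (Homotopic.refl φ)).trans h₁
  have hl' : (f.comp φ).Homotopic l :=
    (homotopic_id_comp hl (f.comp φ)).symm.trans (homotopic_comp_id hgfφ l)
  exact ⟨φ.comp g, h, (hl'.comp (Homotopic.refl g)).trans hl⟩

/-- Continuity of a map out of `I × Y` can be tested after pulling back along a quotient map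
onto `Y`. -/
lemma Topology.IsQuotientMap.continuous_of_prod {π : X → Y} (hπ : IsQuotientMap π) {K : I × Y → Z}
    (hK : Continuous fun p : I × X => K (p.1, π p.2)) : Continuous K := by
  have hc (y : Y) : Continuous fun t : I => K (t, y) := by
    obtain ⟨x, rfl⟩ := hπ.surjective y
    exact hK.comp (by fun_prop : Continuous fun t : I => (t, x))
  let F : Y → C(I, Z) := fun y => ⟨fun t => K (t, y), hc y⟩
  have hF : Continuous F := by
    refine hπ.continuous_iff.2 (continuous_of_continuous_uncurry _ ?_)
    exact hK.comp continuous_swap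
  exact (continuous_uncurry_of_continuous ⟨F, hF⟩).comp continuous_swap

/-- The pushout of two continuous maps `f : E → X` and `i : E → D`. -/
def Glue (f : C(E, X)) (i : C(E, D)) : Type :=
  Quot fun u v : X ⊕ D => ∃ e, u = Sum.inl (f e) ∧ v = Sum.inr (i e)

namespace Glue

variable {f : C(E, X)} {i : C(E, D)}

instance : TopologicalSpace (Glue f i) :=
  inferInstanceAs (TopologicalSpace (Quot _))

/-- The first structure map of the pushout. -/
def inl (f : C(E, X)) (i : C(E, D)) : C(X, Glue f i) :=
  ⟨fun x => Quot.mk _ (Sum.inl x), continuous_quot_mk.comp continuous_inl⟩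

/-- The second structure map of the pushout. -/
def inr (f : C(E, X)) (i : C(E, D)) : C(D, Glue f i) :=
  ⟨fun d => Quot.mk _ (Sum.inr d), continuous_quot_mk.comp continuous_inr⟩

lemma condition (e : E) : inl f i (f e) = inr f i (i e) :=
  Quot.sound ⟨e, rfl, rfl⟩

@[elab_as_elim]
lemma ind {motive : Glue f i → Prop} (inl : ∀ x, motive (inl f i x))
    (inr : ∀ d, motive (inr f i d)) (z : Glue f i) : motive z :=
  Quot.ind (Sum.rec inl inr) z

/-- The map out of the pushout induced by a commutative square. -/
def desc (a : C(X, Z)) (b : C(D, Z)) (h : ∀ e, a (f e) = b (i e)) : C(Glue f i, Z) :=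
  ⟨Quot.lift (Sum.elim a b) (by rintro _ _ ⟨e, rfl, rfl⟩; exact h e),
    continuous_quot_lift _ (Continuous.sumElim a.continuous b.continuous)⟩

@[simp]
lemma desc_inl (a : C(X, Z)) (b : C(D, Z)) (h : ∀ e, a (f e) = b (i e)) (x : X) :
    desc a b h (inl f i x) = a x := rfl

@[simp]
lemma desc_inr (a : C(X, Z)) (b : C(D, Z)) (h : ∀ e, a (f e) = b (i e)) (d : D) :
    desc a b h (inr f i d) = b d := rfl

lemma hom_ext {F G : C(Glue f i, Z)} (hl : ∀ x, F (inl f i x) = G (inl f i x))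
    (hr : ∀ d, F (inr f i d) = G (inr f i d)) : F = G :=
  ContinuousMap.ext (ind hl hr)

/-- Maps out of the cylinder on a pushout are glued from maps on the cylinders of the pieces. -/
lemma exists_cylinder_desc (a : C(I × X, Z)) (b : C(I × D, Z))
    (hab : ∀ t e, a (t, f e) = b (t, i e)) :
    ∃ K : C(I × Glue f i, Z), (∀ t x, K (t, inl f i x) = a (t, x)) ∧
      ∀ t d, K (t, inr f i d) = b (t, d) := by
  let K : I × Glue f i → Z := fun p =>
    desc (f := f) (i := i) (a.comp ⟨fun x => (p.1, x), by fun_prop⟩)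
      (b.comp ⟨fun d => (p.1, d), by fun_prop⟩) (hab p.1) p.2
  have hK : Continuous K := by
    refine (isQuotientMap_quot_mk (X := X ⊕ D)).continuous_of_prod ?_
    let e : I × (X ⊕ D) ≃ₜ (I × X) ⊕ (I × D) := Homeomorph.prodSumDistrib
    refine ((Continuous.sumElim a.continuous b.continuous).comp e.continuous).congr ?_
    rintro ⟨t, x | d⟩ <;> rfl
  exact ⟨⟨K, hK⟩, fun _ _ => rfl, fun _ _ => rfl⟩

lemma homotopic {F G : C(Glue f i, Z)} (a : C(I × X, Z)) (b : C(I × D, Z))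
    (hab : ∀ t e, a (t, f e) = b (t, i e))
    (ha₀ : ∀ x, a (0, x) = F (inl f i x)) (ha₁ : ∀ x, a (1, x) = G (inl f i x))
    (hb₀ : ∀ d, b (0, d) = F (inr f i d)) (hb₁ : ∀ d, b (1, d) = G (inr f i d)) :
    F.Homotopic G := by
  obtain ⟨K, hKl, hKr⟩ := exists_cylinder_desc a b hab
  exact ⟨⟨K, ind (fun x => (hKl 0 x).trans (ha₀ x)) fun d => (hKr 0 d).trans (hb₀ d),
    ind (fun x => (hKl 1 x).trans (ha₁ x)) fun d => (hKr 1 d).trans (hb₁ d)⟩⟩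

/-- The two structure maps of a pushout can be exchanged. -/
def flip (f : C(E, X)) (i : C(E, D)) : Glue f i ≃ₜ Glue i f where
  toFun := desc (inr i f) (inl i f) fun e => (condition e).symm
  invFun := desc (inr f i) (inl f i) fun e => (condition e).symm
  left_inv := ind (fun _ => rfl) fun _ => rfl
  right_inv := ind (fun _ => rfl) fun _ => rfl
  continuous_toFun := ContinuousMap.continuous _
  continuous_invFun := ContinuousMap.continuous _

/-- The map of pushouts induced by composing one leg with `h`. -/
def mapLeft (h : C(X, Y)) (f : C(E, X)) (i : C(E, D)) : C(Glue f i, Glue (h.comp f) i) :=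
  desc ((inl _ _).comp h) (inr _ _) fun e => condition (f := h.comp f) e

end Glue

/-- The homotopy extension property for a continuous map. -/
def HasHEP (i : C(E, D)) : Prop :=
  ∀ (Z : Type) [TopologicalSpace Z] (g : C(D, Z)) (H : C(I × E, Z)),
    (∀ e, H (0, e) = g (i e)) →
      ∃ G : C(I × D, Z), (∀ d, G (0, d) = g d) ∧ ∀ t e, G (t, i e) = H (t, e)

lemma HasHEP.comp {j : C(D, P)} {i : C(E, D)} (hj : HasHEP j) (hi : HasHEP i) :
    HasHEP (j.comp i) := by
  intro Z _ g H h
  obtain ⟨G, hG₀, hG⟩ := hi Z (g.comp j) H h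
  obtain ⟨G', hG'₀, hG'⟩ := hj Z g G hG₀
  exact ⟨G', hG'₀, fun t e => (hG' t (i e)).trans (hG t e)⟩

lemma Homeomorph.hasHEP (e : E ≃ₜ D) : HasHEP (e : C(E, D)) := by
  intro Z _ g H h
  refine ⟨H.comp ⟨fun p => (p.1, e.symm p.2), by fun_prop⟩, fun d => ?_, fun t x => ?_⟩
  · simpa using h (e.symm d)
  · simp

/-- The commutative square `s ∘ i = i' ∘ s'` exhibits `P` as containing the pushout of `i` and
`s'` as a strong deformation retract. -/
structure IsPushoutRetract (i : C(E, D)) (s' : C(E, Q)) (s : C(D, P)) (i' : C(Q, P)) : Prop where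
  comm : ∀ e, s (i e) = i' (s' e)
  extend : ∀ (Z : Type) [TopologicalSpace Z] (g : C(D, Z)) (H : C(Q, Z)),
    (∀ e, H (s' e) = g (i e)) → ∃ G : C(P, Z), (∀ d, G (s d) = g d) ∧ ∀ q, G (i' q) = H q
  retract : ∃ R : C(I × P, P), (∀ p, R (0, p) = p) ∧ (∀ t d, R (t, s d) = s d) ∧
    (∀ t q, R (t, i' q) = i' q) ∧ ∀ p, (∃ d, R (1, p) = s d) ∨ ∃ q, R (1, p) = i' q

namespace IsPushoutRetract

variable {i : C(E, D)} {s' : C(E, Q)} {s : C(D, P)} {i' : C(Q, P)}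

/-- The comparison map between the pushouts. -/
def incl (h : IsPushoutRetract i s' s i') (H : C(Q, X)) :
    C(Glue (H.comp s') i, Glue H i') :=
  Glue.desc (Glue.inl H i') ((Glue.inr H i').comp s) fun e => by
    simp [Glue.condition, h.comm]

lemma exists_retraction (h : IsPushoutRetract i s' s i') (H : C(Q, X)) :
    ∃ ρ : C(Glue H i', Glue (H.comp s') i), (∀ x, ρ (Glue.inl _ _ x) = Glue.inl _ _ x) ∧
      (∀ d, ρ (Glue.inr _ _ (s d)) = Glue.inr _ _ d) ∧
      ρ.comp (h.incl H) = .id _ ∧ ((h.incl H).comp ρ).Homotopic (.id _) := by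
  obtain ⟨R, hR₀, hRs, hRi, hR₁⟩ := h.retract
  obtain ⟨G, hGs, hGi⟩ := h.extend _ (Glue.inr (H.comp s') i) ((Glue.inl (H.comp s') i).comp H)
    fun e => Glue.condition (f := H.comp s') e
  let r : C(P, P) := R.comp ⟨fun p => (1, p), by fun_prop⟩
  let ρ : C(Glue H i', Glue (H.comp s') i) := Glue.desc (Glue.inl _ _) (G.comp r) fun q => by
    simp [r, hRi, hGi]
  have hρs (d : D) : ρ (Glue.inr _ _ (s d)) = Glue.inr _ _ d := by
    simp [ρ, r, hRs, hGs]
  refine ⟨ρ, fun _ => rfl, hρs, Glue.hom_ext (fun _ => rfl) hρs, Homotopic.symm ?_⟩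
  refine Glue.homotopic ((Glue.inl H i').comp .snd) ((Glue.inr H i').comp R) ?_ ?_ ?_ ?_ ?_
  · intro t q
    simp [hRi, Glue.condition]
  · intro x
    rfl
  · intro x
    rfl
  · intro p
    simp [hR₀]
  · intro p
    have key : h.incl H (G (r p)) = Glue.inr H i' (r p) := by
      obtain ⟨d, hd⟩ | ⟨q, hq⟩ := hR₁ p
      · rw [show r p = s d from hd, hGs]
        rfl
      · rw [show r p = i' q from hq, hGi]
        exact Glue.condition q
    exact key.symm

lemma isHomotopyEquiv_incl (h : IsPushoutRetract i s' s i') (H : C(Q, X)) :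
    IsHomotopyEquiv (h.incl H) := by
  obtain ⟨ρ, -, -, h₁, h₂⟩ := h.exists_retraction H
  exact ⟨ρ, h₁ ▸ Homotopic.refl _, h₂⟩

end IsPushoutRetract

/-- The inclusion of `X` into the cylinder `I × X` at time `t`. -/
def cylSlice (t : I) : C(X, I × X) := ⟨fun x => (t, x), by fun_prop⟩

@[simp]
lemma cylSlice_apply (t : I) (x : X) : cylSlice t x = (t, x) := rfl

/-- The map of cylinders induced by `i`. -/
def cylMap (i : C(E, D)) : C(I × E, I × D) := ⟨fun p => (p.1, i p.2), by fun_prop⟩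

@[simp]
lemma cylMap_apply (i : C(E, D)) (p : I × E) : cylMap i p = (p.1, i p.2) := rfl

lemma HasHEP.isPushoutRetract_zero {i : C(E, D)} (hi : HasHEP i) :
    IsPushoutRetract i (cylSlice 0) (cylSlice 0) (cylMap i) where
  comm _ := rfl
  extend Z _ g H h := by
    obtain ⟨G, hG₀, hG⟩ := hi Z g H h
    exact ⟨G, hG₀, fun q => hG q.1 q.2⟩
  retract := by
    let S : Set (I × D) := {p | p.1 = 0 ∨ p.2 ∈ Set.range i}
    obtain ⟨r, hr₀, hr⟩ := hi S ⟨fun d => ⟨(0, d), Or.inl rfl⟩, by fun_prop⟩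
      ⟨fun p => ⟨(p.1, i p.2), Or.inr ⟨p.2, rfl⟩⟩, by fun_prop⟩ fun e => rfl
    have hmem (s t u : I) : (1 - (s : ℝ)) * t + s * u ∈ Set.Icc (0 : ℝ) 1 := by
      have := s.2.1; have := s.2.2; have := t.2.1; have := t.2.2; have := u.2.1; have := u.2.2
      constructor <;> nlinarith
    refine ⟨⟨fun p => (⟨(1 - (p.1 : ℝ)) * p.2.1 + p.1 * (r p.2).1.1, hmem _ _ _⟩,
      (r (p.1 * p.2.1, p.2.2)).1.2), by fun_prop⟩, ?_, ?_, ?_, ?_⟩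
    · rintro ⟨t, d⟩
      simp [hr₀]
    · intro t d
      simp [hr₀]
    · rintro t ⟨u, e⟩
      simp only [cylMap_apply, ContinuousMap.coe_mk, hr]
      exact Prod.ext (Subtype.ext (by simp only; ring)) rfl
    · rintro ⟨t, d⟩
      obtain h | ⟨e, he⟩ := (r (t, d)).2
      · left
        refine ⟨(r (t, d)).1.2, ?_⟩
        simp only [ContinuousMap.coe_mk, one_mul, h]
        exact Prod.ext (Subtype.ext (by simp)) rfl
      · right
        refine ⟨((r (t, d)).1.1, e), ?_⟩
        simp only [ContinuousMap.coe_mk, one_mul, cylMap_apply, he]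
        exact Prod.ext (Subtype.ext (by simp)) rfl

/-- Time reversal on a cylinder. -/
def cylFlip (X : Type) [TopologicalSpace X] : C(I × X, I × X) :=
  ⟨fun p => (σ p.1, p.2), by fun_prop⟩

@[simp]
lemma cylFlip_apply (p : I × X) : cylFlip X p = (σ p.1, p.2) := rfl

lemma HasHEP.isPushoutRetract_one {i : C(E, D)} (hi : HasHEP i) :
    IsPushoutRetract i (cylSlice 1) (cylSlice 1) (cylMap i) where
  comm _ := rfl
  extend Z _ g H h := by
    obtain ⟨G, hG₀, hG⟩ := hi.isPushoutRetract_zero.extend Z g (H.comp (cylFlip E))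
      fun e => by simpa using h e
    exact ⟨G.comp (cylFlip D), fun d => by simpa using hG₀ d,
      fun q => by simpa using hG (σ q.1, q.2)⟩
  retract := by
    obtain ⟨R, hR₀, hRs, hRi, hR₁⟩ := hi.isPushoutRetract_zero.retract
    refine ⟨(cylFlip D).comp (R.comp ⟨fun p => (p.1, cylFlip D p.2), by fun_prop⟩),
      ?_, ?_, ?_, ?_⟩
    · rintro ⟨t, d⟩
      simp [hR₀]
    · intro t d
      have := hRs t d
      simp_all
    · rintro t ⟨u, e⟩
      have := hRi t (σ u, e)
      simp_all
    · rintro ⟨t, d⟩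
      obtain ⟨d', h⟩ | ⟨q, h⟩ := hR₁ (σ t, d)
      · exact Or.inl ⟨d', by simp_all⟩
      · exact Or.inr ⟨(σ q.1, q.2), by simp_all⟩

/-- Homotopic attaching maps give homotopy equivalent pushouts, with control over the
equivalence. -/
lemma HasHEP.exists_equiv_of_homotopy {i : C(E, D)} (hi : HasHEP i) {f₀ f₁ : C(E, X)}
    (H : C(I × E, X)) (h₀ : H.comp (cylSlice 0) = f₀) (h₁ : H.comp (cylSlice 1) = f₁) :
    ∃ φ : C(Glue f₀ i, Glue f₁ i), IsHomotopyEquiv φ ∧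
      (∀ x, φ (Glue.inl _ _ x) = Glue.inl _ _ x) ∧
      ∃ G : C(I × D, Glue f₁ i), (∀ d, G (0, d) = φ (Glue.inr _ _ d)) ∧
        (∀ d, G (1, d) = Glue.inr _ _ d) ∧ ∀ t e, G (t, i e) = Glue.inl _ _ (H (t, e)) := by
  subst h₀ h₁
  obtain ⟨ρ, hρX, hρD, h₁, h₂⟩ := hi.isPushoutRetract_one.exists_retraction H
  have hρ : IsHomotopyEquiv ρ := ⟨_, h₂, h₁ ▸ Homotopic.refl _⟩
  refine ⟨ρ.comp (hi.isPushoutRetract_zero.incl H),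
    hρ.comp (hi.isPushoutRetract_zero.isHomotopyEquiv_incl H), hρX,
    ρ.comp (Glue.inr H (cylMap i)), fun _ => rfl, hρD, fun t e => ?_⟩
  rw [← hρX, Glue.condition]
  rfl

lemma HasHEP.glue_equiv_of_homotopic {i : C(E, D)} (hi : HasHEP i) {f₀ f₁ : C(E, X)}
    (h : f₀.Homotopic f₁) : Nonempty (ContinuousMap.HomotopyEquiv (Glue f₀ i) (Glue f₁ i)) := by
  obtain ⟨H⟩ := h
  obtain ⟨φ, hφ, -⟩ := hi.exists_equiv_of_homotopy H.toContinuousMap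
    (ContinuousMap.ext H.apply_zero) (ContinuousMap.ext H.apply_one)
  exact hφ.nonempty

lemma HasHEP.exists_mapLeft_leftInverse {i : C(E, D)} (hi : HasHEP i) (f : C(E, X))
    {h : C(X, Y)} {k : C(Y, X)} (hkh : (k.comp h).Homotopic (.id X)) :
    ∃ φ : C(Glue (k.comp (h.comp f)) i, Glue f i), IsHomotopyEquiv φ ∧
      (φ.comp ((Glue.mapLeft k (h.comp f) i).comp (Glue.mapLeft h f i))).Homotopic (.id _) := by
  obtain ⟨H⟩ := hkh
  obtain ⟨φ, hφ, hφX, G, hG₀, hG₁, hG⟩ := hi.exists_equiv_of_homotopy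
    (f₀ := k.comp (h.comp f)) (f₁ := f) (H.toContinuousMap.comp (cylMap f))
    (ContinuousMap.ext fun e => H.apply_zero (f e)) (ContinuousMap.ext fun e => H.apply_one (f e))
  refine ⟨φ, hφ, Glue.homotopic ((Glue.inl f i).comp H.toContinuousMap) G ?_ ?_ ?_ ?_ ?_⟩
  · exact fun t e => (hG t e).symm
  · intro x
    exact (congrArg (Glue.inl f i) (H.apply_zero x)).trans (hφX _).symm
  · intro x
    exact congrArg (Glue.inl f i) (H.apply_one x)
  · exact hG₀
  · exact hG₁

/-- Gluing along a map with the homotopy extension property preserves homotopy equivalences. -/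
lemma HasHEP.isHomotopyEquiv_mapLeft {i : C(E, D)} (hi : HasHEP i) (f : C(E, X))
    {h : C(X, Y)} (hh : IsHomotopyEquiv h) : IsHomotopyEquiv (Glue.mapLeft h f i) := by
  obtain ⟨k, h₁, h₂⟩ := hh
  obtain ⟨φ, hφ, hφ'⟩ := hi.exists_mapLeft_leftInverse f h₁
  obtain ⟨ψ, -, hψ⟩ := hi.exists_mapLeft_leftInverse (h.comp f) h₂
  exact hφ.of_comp_comp hφ' (l := ψ.comp (Glue.mapLeft h (k.comp (h.comp f)) i)) hψ

end HomotopyTheory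

section Suspension

variable {X Y Z E : Type} [TopologicalSpace X] [TopologicalSpace Y] [TopologicalSpace Z]
  [TopologicalSpace E]

/-- Homotopy extension from the bottom of a cylinder, relative to its top. -/
lemma exists_cylinder_extension (g : C(X × I, Z)) (H : C(I × X, Z))
    (h : ∀ x, H (0, x) = g (x, 0)) :
    ∃ G : C(I × (X × I), Z), (∀ p, G (0, p) = g p) ∧ (∀ t x, G (t, (x, 0)) = H (t, x)) ∧
      ∀ t x, G (t, (x, 1)) = g (x, 1) := by
  let w : I × (X × I) → ℝ := fun p => p.2.2 * (1 + p.1) - p.1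
  have hw : Continuous w := by fun_prop
  let pr : ℝ → I := Set.projIcc 0 1 zero_le_one
  have hpr : Continuous pr := continuous_projIcc
  have hpr_mem (t : I) : pr t = t := Set.projIcc_val zero_le_one t
  refine ⟨⟨fun p => if 0 ≤ w p then g (p.2.1, pr (w p)) else H (pr (-w p), p.2.1), ?_⟩,
    ?_, ?_, ?_⟩
  · refine Continuous.if_le (by fun_prop) (by fun_prop) continuous_const hw fun p hp => ?_
    rw [← hp, neg_zero, show pr 0 = 0 from hpr_mem 0, h]
  · rintro ⟨x, u⟩
    have hu : w (0, (x, u)) = u := by simp [w]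
    simp only [ContinuousMap.coe_mk, hu, hpr_mem, if_pos u.2.1]
  · intro t x
    have ht : w (t, (x, 0)) = -t := by simp [w]
    simp only [ContinuousMap.coe_mk, ht, neg_neg, hpr_mem]
    split_ifs with h0
    · have : t = 0 := Subtype.ext (le_antisymm (by simpa using h0) t.2.1)
      subst this
      simp [h, show pr 0 = 0 from hpr_mem 0]
    · rfl
  · intro t x
    have ht : w (t, (x, 1)) = 1 := by simp [w]
    simp [ht, show pr 1 = 1 from hpr_mem 1]

/-- The inclusion of `X` in `X × I` at height `u`. -/
def level (u : I) : C(X, X × I) := ⟨fun x => (x, u), by fun_prop⟩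

/-- The mapping cylinder of a continuous map. -/
abbrev MapCyl (f : C(X, Y)) : Type := Glue f (level (X := X) 1)

/-- The inclusion of the free end of the mapping cylinder. -/
def MapCyl.bot (f : C(X, Y)) : C(X, MapCyl f) := (Glue.inr f (level 1)).comp (level 0)

lemma MapCyl.hasHEP_bot (f : C(X, Y)) : HasHEP (MapCyl.bot f) := by
  intro Z _ g H h
  obtain ⟨G, hG₀, hGH, hG₁⟩ := exists_cylinder_extension (g.comp (Glue.inr f (level 1))) H h
  obtain ⟨K, hKl, hKr⟩ := Glue.exists_cylinder_desc (f := f) (i := level 1)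
    ((g.comp (Glue.inl f (level 1))).comp .snd) G fun t x =>
      (congrArg g (Glue.condition x)).trans (hG₁ t x).symm
  exact ⟨K, Glue.ind (hKl 0) fun p => (hKr 0 p).trans (hG₀ p),
    fun t e => (hKr t _).trans (hGH t e)⟩

/-- The projection of the mapping cylinder onto its base. -/
def MapCyl.proj (f : C(X, Y)) : C(MapCyl f, Y) := Glue.desc (.id Y) (f.comp .fst) fun _ => rfl

lemma MapCyl.isHomotopyEquiv_proj (f : C(X, Y)) : IsHomotopyEquiv (MapCyl.proj f) := by
  refine ⟨Glue.inl f (level 1), Homotopic.symm ?_, Homotopic.refl _⟩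
  refine Glue.homotopic ((Glue.inl f (level 1)).comp .snd)
    ((Glue.inr f (level 1)).comp ⟨fun p : I × (X × I) => (p.2.1, p.1 ⊔ p.2.2), by fun_prop⟩)
    ?_ ?_ ?_ ?_ ?_
  · intro t x
    exact (Glue.condition x).trans
      (congrArg (fun u => Glue.inr f (level 1) (x, u)) (max_eq_right le_one').symm)
  · exact fun _ => rfl
  · exact fun _ => rfl
  · rintro ⟨x, u⟩
    simp
  · rintro ⟨x, u⟩
    exact (congrArg (fun v => Glue.inr f (level 1) (x, v)) (max_eq_left le_one')).trans
      (Glue.condition x).symm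

namespace Susp

/-- The projection of the cylinder onto the suspension. -/
def mk : C(X × I, Susp X) := ⟨fun p => Quot.mk _ p, continuous_quot_mk⟩

lemma isQuotientMap_mk : IsQuotientMap (mk : C(X × I, Susp X)) := isQuotientMap_quot_mk

lemma mk_zero (x y : X) : mk (x, 0) = mk (y, 0) := Quot.sound ⟨rfl, Or.inl rfl⟩

lemma mk_one (x y : X) : mk (x, 1) = mk (y, 1) := Quot.sound ⟨rfl, Or.inr rfl⟩

@[elab_as_elim]
lemma ind {motive : Susp X → Prop} (mk : ∀ x t, motive (mk (x, t))) (z : Susp X) : motive z :=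
  Quot.ind (fun p => mk p.1 p.2) z

/-- The map out of a suspension induced by a map constant on both ends of the cylinder. -/
def desc (g : C(X × I, Z)) (h₀ : ∀ x y, g (x, 0) = g (y, 0)) (h₁ : ∀ x y, g (x, 1) = g (y, 1)) :
    C(Susp X, Z) :=
  ⟨Quot.lift g (by
    rintro ⟨x, s⟩ ⟨y, t⟩ ⟨rfl : s = t, rfl | rfl⟩
    exacts [h₀ x y, h₁ x y]), continuous_quot_lift _ g.continuous⟩

lemma exists_cylinder_desc (G : C(I × (X × I), Z)) (h₀ : ∀ t x y, G (t, (x, 0)) = G (t, (y, 0)))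
    (h₁ : ∀ t x y, G (t, (x, 1)) = G (t, (y, 1))) :
    ∃ K : C(I × Susp X, Z), ∀ t p, K (t, mk p) = G (t, p) := by
  let K : I × Susp X → Z := fun p =>
    desc (G.comp ⟨fun x => (p.1, x), by fun_prop⟩) (h₀ p.1) (h₁ p.1) p.2
  exact ⟨⟨K, isQuotientMap_mk.continuous_of_prod (K := K) G.continuous⟩, fun _ _ => rfl⟩

/-- Functoriality of the suspension. -/
def map (f : C(X, Y)) : C(Susp X, Susp Y) :=
  desc (mk.comp ⟨fun p => (f p.1, p.2), by fun_prop⟩) (fun _ _ => mk_zero _ _)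
    fun _ _ => mk_one _ _

lemma map_homotopic {f g : C(X, Y)} (h : f.Homotopic g) : (map f).Homotopic (map g) := by
  obtain ⟨H⟩ := h
  obtain ⟨K, hK⟩ := exists_cylinder_desc
    (mk.comp ⟨fun p : I × (X × I) => (H (p.1, p.2.1), p.2.2), by fun_prop⟩)
    (fun _ _ _ => mk_zero _ _) fun _ _ _ => mk_one _ _
  refine ⟨⟨K, ind fun x t => (hK _ _).trans ?_, ind fun x t => (hK _ _).trans ?_⟩⟩
  · exact congrArg (fun y => mk (y, t)) (H.apply_zero x)
  · exact congrArg (fun y => mk (y, t)) (H.apply_one x)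

lemma map_id : map (.id X) = .id _ := ContinuousMap.ext (ind fun _ _ => rfl)

lemma map_comp (g : C(Y, Z)) (f : C(X, Y)) : map (g.comp f) = (map g).comp (map f) :=
  ContinuousMap.ext (ind fun _ _ => rfl)

lemma isHomotopyEquiv_map {f : C(X, Y)} (hf : IsHomotopyEquiv f) : IsHomotopyEquiv (map f) := by
  obtain ⟨g, h₁, h₂⟩ := hf
  refine ⟨map g, ?_, ?_⟩
  · simpa only [map_comp, map_id] using map_homotopic h₁
  · simpa only [map_comp, map_id] using map_homotopic h₂

lemma hasHEP_pole (x₀ : X) : HasHEP (.const Unit (mk (x₀, 0))) := by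
  intro Z _ g H h
  obtain ⟨G, hG₀, hGH, hG₁⟩ := exists_cylinder_extension (g.comp mk)
    (H.comp ⟨fun p : I × X => (p.1, ()), by fun_prop⟩)
    fun x => (h ()).trans (congrArg g (mk_zero x₀ x))
  obtain ⟨K, hK⟩ := exists_cylinder_desc G (fun t x y => (hGH t x).trans (hGH t y).symm)
    fun t x y => ((hG₁ t x).trans (congrArg g (mk_one x y))).trans (hG₁ t y).symm
  exact ⟨K, ind fun x t => (hK _ _).trans (hG₀ _), fun t _ => (hK _ _).trans (hGH t x₀)⟩

lemma joined_pole (x₀ : X) (z : Susp X) : Joined z (mk (x₀, 0)) := by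
  induction z using ind with
  | mk x t =>
    exact ⟨⟨mk.comp ⟨fun u => (x, σ u * t), by fun_prop⟩, by simp, by simp [mk_zero x x₀]⟩⟩

end Susp

lemma Joined.const_homotopic {x y : X} (h : Joined x y) :
    (ContinuousMap.const E x).Homotopic (.const E y) :=
  ⟨⟨⟨fun p => h.somePath p.1, by fun_prop⟩, by simp, by simp⟩⟩

end Suspension

section Sphere

instance (k : ℕ) : CompactSpace (NSphere k) :=
  inferInstanceAs (CompactSpace (Metric.sphere (0 : EuclideanSpace ℝ (Fin (k + 1))) 1))

instance (k : ℕ) : T2Space (NSphere k) :=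
  inferInstanceAs (T2Space (Metric.sphere (0 : EuclideanSpace ℝ (Fin (k + 1))) 1))

instance (k : ℕ) : Nonempty (NSphere k) :=
  (NormedSpace.sphere_nonempty.2 zero_le_one).to_subtype

instance {X : Type} [TopologicalSpace X] [CompactSpace X] : CompactSpace (Susp X) :=
  inferInstanceAs (CompactSpace (Quot _))

lemma sum_sq_eq_one {k : ℕ} (x : NSphere k) : ∑ j, x.1 j ^ 2 = 1 := by
  have h : ‖x.1‖ = 1 := mem_sphere_zero_iff_norm.1 x.2
  have := EuclideanSpace.real_norm_sq_eq x.1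
  rw [← this, h, one_pow]

/-- A vector of coordinates whose squares sum to one, as a point of the sphere. -/
def NSphere.ofCoords {k : ℕ} (v : Fin (k + 1) → ℝ) (hv : ∑ j, v j ^ 2 = 1) : NSphere k :=
  ⟨WithLp.toLp 2 v, mem_sphere_zero_iff_norm.2 (by
    rw [EuclideanSpace.norm_eq, Real.sqrt_eq_one]
    simpa using hv)⟩

lemma NSphere.ext {k : ℕ} {x y : NSphere k} (h : ∀ j, x.1 j = y.1 j) : x = y :=
  Subtype.ext (PiLp.ext h)

/-- The polar coordinates map from the cylinder on a sphere to the next sphere. -/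
noncomputable def polarMap (k : ℕ) : C(NSphere k × I, NSphere (k + 1)) where
  toFun p := NSphere.ofCoords
    (Fin.cons (Real.cos (Real.pi * p.2)) fun j => Real.sin (Real.pi * p.2) * p.1.1 j) (by
      rw [Fin.sum_univ_succ]
      simp [mul_pow, ← Finset.mul_sum, sum_sq_eq_one])
  continuous_toFun := by
    refine Continuous.subtype_mk ((PiLp.continuous_toLp 2 _).comp (continuous_pi fun j => ?_)) _
    have hval : Continuous fun p : NSphere k × I => p.1.1 :=
      continuous_subtype_val.comp continuous_fst
    refine Fin.cases ?_ (fun j => ?_) j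
    · simp only [Fin.cons_zero]
      fun_prop
    · simp only [Fin.cons_succ]
      fun_prop

lemma polarMap_zero {k : ℕ} (x : NSphere k) (t : I) :
    (polarMap k (x, t)).1 0 = Real.cos (Real.pi * t) := rfl

lemma polarMap_succ {k : ℕ} (x : NSphere k) (t : I) (j : Fin (k + 1)) :
    (polarMap k (x, t)).1 j.succ = Real.sin (Real.pi * t) * x.1 j := rfl

lemma pi_mul_mem (t : I) : Real.pi * t ∈ Set.Icc 0 Real.pi :=
  ⟨mul_nonneg Real.pi_pos.le t.2.1, mul_le_of_le_one_right Real.pi_pos.le t.2.2⟩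

/-- The suspension of a sphere maps to the next sphere. -/
noncomputable def suspToSphere (k : ℕ) : C(Susp (NSphere k), NSphere (k + 1)) :=
  Susp.desc (polarMap k)
    (fun x y => NSphere.ext (Fin.cases rfl fun j => by simp [polarMap_succ]))
    (fun x y => NSphere.ext (Fin.cases rfl fun j => by simp [polarMap_succ]))

lemma suspToSphere_mk {k : ℕ} (p : NSphere k × I) : suspToSphere k (Susp.mk p) = polarMap k p := rfl

lemma suspToSphere_injective (k : ℕ) : Function.Injective (suspToSphere k) := by
  intro z w h
  induction z using Susp.ind with | mk x s =>
  induction w using Susp.ind with | mk y t =>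
  rw [suspToSphere_mk, suspToSphere_mk] at h
  have hst : s = t := by
    have h0 : Real.cos (Real.pi * s) = Real.cos (Real.pi * t) := by
      rw [← polarMap_zero x, h, polarMap_zero]
    exact Subtype.ext (mul_left_cancel₀ Real.pi_ne_zero
      (Real.injOn_cos (pi_mul_mem s) (pi_mul_mem t) h0))
  subst hst
  by_cases h0 : s = 0
  · rw [h0, Susp.mk_zero]
  by_cases h1 : s = 1
  · rw [h1, Susp.mk_one]
  have hsin : 0 < Real.sin (Real.pi * s) := by
    have hs0 : 0 < (s : ℝ) := lt_of_le_of_ne s.2.1 fun h => h0 (Subtype.ext h.symm)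
    have hs1 : (s : ℝ) < 1 := lt_of_le_of_ne s.2.2 fun h => h1 (Subtype.ext h)
    exact Real.sin_pos_of_pos_of_lt_pi (mul_pos Real.pi_pos hs0)
      (mul_lt_of_lt_one_right Real.pi_pos hs1)
  have hxy : x = y := NSphere.ext fun j => mul_left_cancel₀ hsin.ne' (by
    rw [← polarMap_succ, h, polarMap_succ])
  rw [hxy]

lemma suspToSphere_surjective (k : ℕ) : Function.Surjective (suspToSphere k) := by
  intro y
  have hy := sum_sq_eq_one y
  rw [Fin.sum_univ_succ] at hy
  have hnn : 0 ≤ ∑ j : Fin (k + 1), y.1 j.succ ^ 2 := Finset.sum_nonneg fun _ _ => sq_nonneg _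
  have hle : -1 ≤ y.1 0 := by nlinarith
  have hle' : y.1 0 ≤ 1 := by nlinarith
  let t : I := ⟨Real.arccos (y.1 0) / Real.pi,
    div_nonneg (Real.arccos_nonneg _) Real.pi_pos.le,
    div_le_one_of_le₀ (Real.arccos_le_pi _) Real.pi_pos.le⟩
  have ht : Real.pi * t = Real.arccos (y.1 0) := mul_div_cancel₀ _ Real.pi_ne_zero
  have hcos : Real.cos (Real.pi * t) = y.1 0 := by rw [ht, Real.cos_arccos hle hle']
  have hsq : ∑ j : Fin (k + 1), y.1 j.succ ^ 2 = Real.sin (Real.pi * t) ^ 2 := by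
    rw [Real.sin_sq, hcos]
    linarith
  by_cases hsin : Real.sin (Real.pi * t) = 0
  · refine ⟨Susp.mk (Classical.arbitrary _, t), NSphere.ext (Fin.cases hcos fun j => ?_)⟩
    rw [suspToSphere_mk, polarMap_succ, hsin, zero_mul]
    rw [hsin, zero_pow two_ne_zero, Finset.sum_eq_zero_iff_of_nonneg fun _ _ => sq_nonneg _] at hsq
    exact (pow_eq_zero_iff two_ne_zero).1 (hsq j (Finset.mem_univ _)) |>.symm
  · refine ⟨Susp.mk (NSphere.ofCoords (fun j => y.1 j.succ / Real.sin (Real.pi * t)) ?_, t),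
      NSphere.ext (Fin.cases hcos fun j => ?_)⟩
    · simp only [div_pow, ← Finset.sum_div, hsq]
      exact div_self (pow_ne_zero 2 hsin)
    · rw [suspToSphere_mk, polarMap_succ]
      exact mul_div_cancel₀ _ hsin

/-- The suspension of the `k`-sphere is the `(k + 1)`-sphere. -/
noncomputable def suspHomeoSphere (k : ℕ) : Susp (NSphere k) ≃ₜ NSphere (k + 1) :=
  Continuous.homeoOfEquivCompactToT2
    (f := Equiv.ofBijective (suspToSphere k) ⟨suspToSphere_injective k, suspToSphere_surjective k⟩)
    (suspToSphere k).continuous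

lemma exists_sphere_pole (k : ℕ) : ∃ q : NSphere (k + 1), HasHEP (.const Unit q) ∧
    ∀ x, Joined x q := by
  let x₀ : NSphere k := Classical.arbitrary _
  let e := suspHomeoSphere k
  refine ⟨e (Susp.mk (x₀, 0)), e.hasHEP.comp (Susp.hasHEP_pole x₀), fun x => ?_⟩
  simpa using (Susp.joined_pole x₀ (e.symm x)).map e.continuous

end Sphere

section Complex

variable {V : Type} [Fintype V]

lemma realization_eq_support (K : Finset (Finset V)) (x : V → ℝ) :
    x ∈ realization K ↔ (∀ v, 0 ≤ x v) ∧ ∑ v, x v = 1 ∧ (univ.filter fun v => x v ≠ 0) ∈ K := by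
  refine and_congr_right fun _ => and_congr_right fun _ => ⟨?_, fun h => ⟨_, h, by simp⟩⟩
  rintro ⟨s, hs, h⟩
  convert hs
  ext v
  simp [← h]

lemma support_nonempty {x : V → ℝ} (hx : ∑ v, x v = 1) :
    (univ.filter fun v => x v ≠ 0).Nonempty := by
  by_contra h
  rw [not_nonempty_iff_eq_empty, filter_eq_empty_iff] at h
  simp only [not_not] at h
  rw [Finset.sum_eq_zero fun v hv => h hv] at hx
  exact zero_ne_one hx

lemma mem_realization_of_support {K : Finset (Finset V)} (hK : IsComplex K) {x : V → ℝ}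
    (h0 : ∀ v, 0 ≤ x v) (h1 : ∑ v, x v = 1) {s : Finset V} (hs : s ∈ K)
    (h : ∀ v ∉ s, x v = 0) : x ∈ realization K := by
  refine (realization_eq_support K x).2 ⟨h0, h1, (hK s hs).2 _ (fun v hv => ?_)
    (support_nonempty h1)⟩
  by_contra hvs
  exact (mem_filter.1 hv).2 (h v hvs)

lemma isCompact_realization {K : Finset (Finset V)} (hK : IsComplex K) :
    IsCompact (realization K) := by
  have : realization K = ⋃ s ∈ K, stdSimplex ℝ V ∩ {x | ∀ v ∉ s, x v = 0} := by
    ext x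
    simp only [Set.mem_iUnion, exists_prop]
    constructor
    · rintro ⟨h0, h1, s, hs, h⟩
      exact ⟨s, hs, ⟨h0, h1⟩, fun v hv => not_not.1 fun hx => hv ((h v).1 hx)⟩
    · rintro ⟨s, hs, ⟨h0, h1⟩, h⟩
      exact mem_realization_of_support hK h0 h1 hs h
  rw [this]
  refine K.finite_toSet.isCompact_biUnion fun s _ => (isCompact_stdSimplex ℝ V).inter_right ?_
  simp only [Set.ofPred_forall]
  exact isClosed_iInter fun v => isClosed_iInter fun _ =>
    isClosed_eq (continuous_apply v) continuous_const

/-- A retraction of the cylinder `I × D` onto `{0} × D ∪ I × E` yields the homotopy extension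
property for a closed embedding `E → D`. -/
lemma hasHEP_of_retraction {D E : Type} [TopologicalSpace D] [TopologicalSpace E] {i : C(E, D)}
    (hi : IsClosedEmbedding i) (r : C(I × D, I × D))
    (hr : ∀ p, (r p).1 = 0 ∨ (r p).2 ∈ Set.range i) (hr₀ : ∀ d, r (0, d) = (0, d))
    (hri : ∀ t e, r (t, i e) = (t, i e)) : HasHEP i := by
  intro Z _ g H h
  classical
  let e : E ≃ₜ Set.range i := hi.isEmbedding.toHomeomorph
  let G : I × D → Z := fun p =>
    if hp : (r p).2 ∈ Set.range i then H ((r p).1, e.symm ⟨(r p).2, hp⟩) else g (r p).2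
  have hGi (p : I × D) (x : E) (hx : (r p).2 = i x) : G p = H ((r p).1, x) := by
    have hp : (r p).2 ∈ Set.range i := ⟨x, hx.symm⟩
    have : e.symm ⟨(r p).2, hp⟩ = x := e.symm_apply_eq.2 (Subtype.ext hx)
    simp only [G, dif_pos hp, this]
  have hG₀ (p : I × D) (hp : (r p).1 = 0) : G p = g (r p).2 := by
    by_cases hpi : (r p).2 ∈ Set.range i
    · obtain ⟨x, hx⟩ := hpi
      rw [hGi p x hx.symm, hp, h, hx]
    · simp only [G, dif_neg hpi]
  have hc₀ : ContinuousOn G {p | (r p).1 = 0} :=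
    (by fun_prop : Continuous fun p => g (r p).2).continuousOn.congr fun p hp => hG₀ p hp
  have hci : ContinuousOn G {p | (r p).2 ∈ Set.range i} := by
    rw [continuousOn_iff_continuous_domRestrict]
    have : Continuous fun p : {p | (r p).2 ∈ Set.range i} =>
        H ((r p).1, e.symm ⟨(r p).2, p.2⟩) := by
      fun_prop
    refine this.congr fun p => ?_
    simp only [Set.domRestrict_apply, G]
    have hp : (r p).2 ∈ Set.range i := p.2
    rw [dif_pos hp]
  have hcont : Continuous G := by
    rw [← continuousOn_univ]
    convert hc₀.union_of_isClosed hci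
      (isClosed_eq (by fun_prop) continuous_const) (hi.isClosed_range.preimage (by fun_prop))
    exact (Set.eq_univ_of_forall hr).symm
  refine ⟨⟨G, hcont⟩, fun d => ?_, fun t x => ?_⟩
  · exact (hG₀ _ (by rw [hr₀])).trans (by rw [hr₀])
  · exact (hGi _ x (by rw [hri])).trans (by rw [hri])

lemma isClosedEmbedding_inclMap {K L : Finset (Finset V)} (hK : IsComplex K) (h : K ⊆ L) :
    IsClosedEmbedding (inclMap h) := by
  have : CompactSpace (realization K) := isCompact_iff_compactSpace.1 (isCompact_realization hK)
  exact (inclMap h).continuous.isClosedEmbedding (Set.inclusion_injective (realization_mono h))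

lemma mem_range_inclMap {K L : Finset (Finset V)} (h : K ⊆ L) (x : realization L) :
    x ∈ Set.range (inclMap h) ↔ x.1 ∈ realization K :=
  ⟨by rintro ⟨y, rfl⟩; exact y.2, fun hx => ⟨⟨x.1, hx⟩, rfl⟩⟩

/-- Attaching a single simplex along its boundary has the homotopy extension property. -/
lemma hasHEP_inclMap_insert [DecidableEq V] {K : Finset (Finset V)} {s : Finset V}
    (hK : IsComplex K) (hL : IsComplex (insert s K)) (hs : s ∉ K) :
    HasHEP (inclMap (subset_insert s K)) := by
  have hsne : s.Nonempty := (hL s (mem_insert_self s K)).1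
  let m : (V → ℝ) → ℝ := fun x => s.inf' hsne x
  have hmc : Continuous m := Continuous.finset_inf'_apply hsne fun v _ => continuous_apply v
  have hm_le (x : V → ℝ) {v : V} (hv : v ∈ s) : m x ≤ x v := inf'_le x hv
  have hm_nonneg {x : V → ℝ} (hx : ∀ v, 0 ≤ x v) : 0 ≤ m x := le_inf' hsne x fun v _ => hx v
  have hm_min (x : V → ℝ) : ∃ v ∈ s, x v = m x := by
    obtain ⟨v, hv, h⟩ := exists_mem_eq_inf' hsne x
    exact ⟨v, hv, h.symm⟩
  have hk : 0 < (#s : ℝ) := Nat.cast_pos.2 hsne.card_pos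
  have hmem {x : V → ℝ} (hx : x ∈ realization (insert s K)) :
      x ∈ realization K ↔ m x = 0 := by
    rw [realization_eq_support] at hx ⊢
    obtain ⟨h0, h1, hx⟩ := hx
    refine ⟨fun ⟨_, _, h⟩ => ?_, fun h => ⟨h0, h1, (mem_insert.1 hx).resolve_left fun hsupp => ?_⟩⟩
    · by_contra hne
      refine hs ((hK _ h).2 s (fun v hv => ?_) hsne)
      have := lt_of_le_of_ne (hm_nonneg h0) (Ne.symm hne)
      simpa using (this.trans_le (hm_le x hv)).ne'
    · obtain ⟨v, hv, hxv⟩ := hm_min x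
      rw [← hsupp, mem_filter, hxv] at hv
      exact hv.2 h
  have hsupp {x : V → ℝ} (hx : x ∈ realization (insert s K)) (hmx : m x ≠ 0) {v : V}
      (hv : v ∉ s) : x v = 0 := by
    have hxK := mt (hmem hx).1 hmx
    rw [realization_eq_support] at hx hxK
    obtain ⟨h0, h1, hx⟩ := hx
    obtain h | h := mem_insert.1 hx
    · rw [← h] at hv
      simpa using hv
    · exact absurd ⟨h0, h1, h⟩ hxK
  let β : V → ℝ := fun v => if v ∈ s then 1 / (#s : ℝ) else 0
  have hβ : ∑ v, β v = 1 := by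
    simp [β, hk.ne']
  let μ : I × realization (insert s K) → ℝ := fun p => max (1 - p.1 / 2) (1 - #s * m p.2)
  have hμc : Continuous μ := by fun_prop
  have hμt (p) : 1 - (p.1 : ℝ) / 2 ≤ μ p := le_max_left _ _
  have hμm (p) : 1 - #s * m p.2 ≤ μ p := le_max_right _ _
  have hμpos (p) : 0 < μ p := by
    have := hμt p
    have := p.1.2.2
    linarith
  have hμle (p) : μ p ≤ 1 := by
    have := p.1.2.1
    have := mul_nonneg hk.le (hm_nonneg p.2.2.1)
    exact max_le (by linarith) (by linarith)
  have hμm0 (p) (h : m p.2.1 = 0) : μ p = 1 :=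
    le_antisymm (hμle p) (by simpa [h] using hμm p)
  let ξ : I × realization (insert s K) → V → ℝ := fun p v => β v + (p.2.1 v - β v) / μ p
  have hξ1 (p) (h : μ p = 1) : ξ p = p.2.1 := by
    ext v
    simp [ξ, h]
  have hξ (p) : ξ p ∈ realization (insert s K) := by
    by_cases h : m p.2.1 = 0
    · rw [hξ1 p (hμm0 p h)]
      exact p.2.2
    · refine mem_realization_of_support hL (fun v => ?_) ?_ (mem_insert_self s K) fun v hv => ?_
      · by_cases hv : v ∈ s
        · simp only [ξ, β, if_pos hv]
          have h1 := hm_le p.2.1 hv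
          have h2 := hμm p
          have : 0 ≤ μ p + #s * p.2.1 v - 1 := by nlinarith
          have heq : 1 / (#s : ℝ) + (p.2.1 v - 1 / #s) / μ p =
              (μ p + #s * p.2.1 v - 1) / (#s * μ p) := by
            have := (hμpos p).ne'
            have := hk.ne'
            field_simp
            ring
          rw [heq]
          exact div_nonneg this (mul_pos hk (hμpos p)).le
        · simp [ξ, β, hv, hsupp p.2.2 h hv]
      · simp only [ξ, sum_add_distrib, ← sum_div, sum_sub_distrib, hβ, p.2.2.2.1]
        simp
      · simp [ξ, β, hv, hsupp p.2.2 h hv]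
  have hτ (p) : 2 + ((p.1 : ℝ) - 2) / μ p ∈ Set.Icc (0 : ℝ) 1 := by
    have h0 := hμpos p
    have h1 := hμle p
    have h2 := hμt p
    have h3 := p.1.2.1
    have h4 := p.1.2.2
    have heq : 2 + ((p.1 : ℝ) - 2) / μ p = (2 * μ p + p.1 - 2) / μ p := by
      field_simp
      ring
    rw [heq]
    refine ⟨div_nonneg (by linarith) h0.le, (div_le_one h0).2 (by linarith)⟩
  have hξc : Continuous ξ := by
    refine continuous_pi fun v => ?_
    have hv : Continuous fun p : I × realization (insert s K) => p.2.1 v :=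
      (continuous_apply v).comp (continuous_subtype_val.comp continuous_snd)
    exact continuous_const.add ((hv.sub continuous_const).div hμc fun p => (hμpos p).ne')
  have hτc : Continuous fun p : I × realization (insert s K) => 2 + ((p.1 : ℝ) - 2) / μ p :=
    continuous_const.add
      ((by fun_prop : Continuous fun p : I × realization (insert s K) => (p.1 : ℝ) - 2).div hμc
        fun p => (hμpos p).ne')
  let r : C(I × realization (insert s K), I × realization (insert s K)) :=
    ⟨fun p => (⟨_, hτ p⟩, ⟨ξ p, hξ p⟩), (hτc.subtype_mk _).prodMk (hξc.subtype_mk _)⟩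
  have hr1 (p) (h : μ p = 1) : r p = p :=
    Prod.ext (Subtype.ext (by simp [r, h])) (Subtype.ext (hξ1 p h))
  refine hasHEP_of_retraction (isClosedEmbedding_inclMap hK _) r (fun p => ?_) (fun x => ?_)
    fun t x => ?_
  · obtain h | h := max_choice (1 - (p.1 : ℝ) / 2) (1 - #s * m p.2)
    · left
      have hne := (hμpos p).ne'
      refine Subtype.ext ?_
      change 2 + ((p.1 : ℝ) - 2) / μ p = 0
      have : (p.1 : ℝ) - 2 = -2 * μ p := by
        rw [show μ p = 1 - (p.1 : ℝ) / 2 from h]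
        ring
      rw [this, mul_div_cancel_right₀ _ hne]
      norm_num
    · right
      rw [mem_range_inclMap]
      refine (hmem (hξ p)).2 (le_antisymm ?_ (hm_nonneg (hξ p).1))
      obtain ⟨v, hv, hxv⟩ := hm_min p.2.1
      refine (hm_le _ hv).trans_eq ?_
      have hne := (hμpos p).ne'
      simp only [ξ, β, if_pos hv, hxv]
      have : m p.2.1 - 1 / (#s : ℝ) = -(1 / #s) * μ p := by
        rw [show μ p = 1 - #s * m p.2 from h]
        field_simp
        ring
      rw [this, mul_div_cancel_right₀ _ hne, add_neg_cancel]
  · exact hr1 _ (le_antisymm (hμle _) (by simpa using hμt (0, x)))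
  · exact hr1 _ (hμm0 _ ((hmem (inclMap _ x).2).1 x.2))

/-- The inclusion of a subcomplex has the homotopy extension property. -/
lemma hasHEP_inclMap [DecidableEq V] {K L : Finset (Finset V)} (hK : IsComplex K)
    (hL : IsComplex L) (h : K ⊆ L) : HasHEP (inclMap h) := by
  induction hn : #(L \ K) generalizing K with
  | zero =>
    obtain rfl : K = L := h.antisymm (sdiff_eq_empty_iff_subset.1 (card_eq_zero.1 hn))
    exact (Homeomorph.refl _).hasHEP
  | succ n ih =>
    obtain ⟨s, hs, hmin⟩ := exists_min_image (L \ K) card (card_pos.1 (by omega))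
    rw [mem_sdiff] at hs
    have hK' : IsComplex (insert s K) := by
      intro t ht
      obtain rfl | ht := mem_insert.1 ht
      · refine ⟨(hL t hs.1).1, fun u hu hune => ?_⟩
        by_contra hcon
        rw [mem_insert, not_or] at hcon
        have huL := (hL t hs.1).2 u hu hune
        exact hcon.1 (eq_of_subset_of_card_le hu (hmin u (mem_sdiff.2 ⟨huL, hcon.2⟩)))
      · exact ⟨(hK t ht).1, fun u hu hune => mem_insert_of_mem ((hK t ht).2 u hu hune)⟩
    have hle : insert s K ⊆ L := insert_subset hs.1 h
    have hcard : #(L \ insert s K) = n := by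
      rw [sdiff_insert, card_erase_of_mem (mem_sdiff.2 hs), hn, Nat.add_sub_cancel]
    exact (ih hK' hle hcard).comp (hasHEP_inclMap_insert hK hK' hs.2)

/-- The realization of a union is the pushout of the realizations along the intersection. -/
lemma nonempty_homeomorph_glue_union [DecidableEq V] {A B : Finset (Finset V)}
    (hA : IsComplex A) (hB : IsComplex B) :
    Nonempty (Glue (inclMap (inter_subset_left : A ∩ B ⊆ A))
      (inclMap (inter_subset_right : A ∩ B ⊆ B)) ≃ₜ realization (A ∪ B)) := by
  have : CompactSpace (realization A) := isCompact_iff_compactSpace.1 (isCompact_realization hA)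
  have : CompactSpace (realization B) := isCompact_iff_compactSpace.1 (isCompact_realization hB)
  have : CompactSpace (Glue (inclMap (inter_subset_left : A ∩ B ⊆ A))
      (inclMap (inter_subset_right : A ∩ B ⊆ B))) := inferInstanceAs (CompactSpace (Quot _))
  let F : C(Glue (inclMap (inter_subset_left : A ∩ B ⊆ A))
      (inclMap (inter_subset_right : A ∩ B ⊆ B)), realization (A ∪ B)) :=
    Glue.desc (inclMap subset_union_left) (inclMap subset_union_right) fun _ => rfl
  have hAB {x : V → ℝ} (hxA : x ∈ realization A) (hxB : x ∈ realization B) :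
      x ∈ realization (A ∩ B) := by
    rw [realization_eq_support] at *
    exact ⟨hxA.1, hxA.2.1, mem_inter.2 ⟨hxA.2.2, hxB.2.2⟩⟩
  have hinj : Function.Injective F := by
    intro z w h
    induction z using Glue.ind with
    | inl x =>
      induction w using Glue.ind with
      | inl y => exact congrArg _ (Set.inclusion_injective (realization_mono subset_union_left) h)
      | inr y =>
        obtain ⟨x, hx⟩ := x
        obtain ⟨y, hy⟩ := y
        obtain rfl : x = y := congrArg Subtype.val h
        exact Glue.condition (⟨x, hAB hx hy⟩ : realization (A ∩ B))
    | inr x =>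
      induction w using Glue.ind with
      | inl y =>
        obtain ⟨x, hx⟩ := x
        obtain ⟨y, hy⟩ := y
        obtain rfl : x = y := congrArg Subtype.val h
        exact (Glue.condition (⟨x, hAB hy hx⟩ : realization (A ∩ B))).symm
      | inr y => exact congrArg _ (Set.inclusion_injective (realization_mono subset_union_right) h)
  have hsurj : Function.Surjective F := by
    rintro ⟨x, h0, h1, s, hs, h⟩
    obtain hs | hs := mem_union.1 hs
    · exact ⟨Glue.inl _ _ ⟨x, h0, h1, s, hs, h⟩, rfl⟩
    · exact ⟨Glue.inr _ _ ⟨x, h0, h1, s, hs, h⟩, rfl⟩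
  exact ⟨Continuous.homeoOfEquivCompactToT2 (f := Equiv.ofBijective F ⟨hinj, hsurj⟩) F.continuous⟩

end Complex

section Wedge

variable {X Y Z : Type} [TopologicalSpace X] [TopologicalSpace Y] [TopologicalSpace Z]

/-- The wedge of two pointed spaces. -/
abbrev Wedge2 (x₀ : X) (y₀ : Y) : Type :=
  Glue (.const Unit x₀ : C(Unit, X)) (.const Unit y₀ : C(Unit, Y))

/-- The base point of a wedge. -/
def Wedge2.base (x₀ : X) (y₀ : Y) : Wedge2 x₀ y₀ := Glue.inl _ _ x₀

/-- The triple wedge is an iterated wedge. -/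
def wedge3Homeo (x₀ : X) (y₀ : Y) (z₀ : Z) :
    Wedge2 (Wedge2.base x₀ y₀) z₀ ≃ₜ Wedge3 X Y Z x₀ y₀ z₀ where
  toFun :=
    let mk : C(X ⊕ Y ⊕ Z, Wedge3 X Y Z x₀ y₀ z₀) := ⟨Quot.mk _, continuous_quot_mk⟩
    Glue.desc (f := .const Unit (Wedge2.base x₀ y₀)) (i := .const Unit z₀)
      (Glue.desc (f := .const Unit x₀) (i := .const Unit y₀) (mk.comp ⟨Sum.inl, continuous_inl⟩)
        (mk.comp ⟨fun y => Sum.inr (Sum.inl y), continuous_inr.comp continuous_inl⟩)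
        fun _ => Quot.sound (Or.inl ⟨rfl, rfl⟩))
      (mk.comp ⟨fun z => Sum.inr (Sum.inr z), continuous_inr.comp continuous_inr⟩)
      fun _ => Quot.sound (Or.inr ⟨rfl, rfl⟩)
  invFun := Quot.lift
    (Sum.elim ((Glue.inl _ _).comp (Glue.inl _ _))
      (Sum.elim ((Glue.inl _ _).comp (Glue.inr _ _)) (Glue.inr _ _))) (by
    rintro _ _ (⟨rfl, rfl⟩ | ⟨rfl, rfl⟩)
    · exact congrArg (Glue.inl _ _) (Glue.condition ())
    · exact Glue.condition (f := .const Unit (Wedge2.base x₀ y₀)) ())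
  left_inv := Glue.ind (Glue.ind (fun _ => rfl) fun _ => rfl) fun _ => rfl
  right_inv := Quot.ind (Sum.rec (fun _ => rfl) (Sum.rec (fun _ => rfl) fun _ => rfl))
  continuous_toFun := ContinuousMap.continuous _
  continuous_invFun := continuous_quot_lift _ (Continuous.sumElim (ContinuousMap.continuous _)
    (Continuous.sumElim (ContinuousMap.continuous _) (ContinuousMap.continuous _)))

/-- The double mapping cylinder of two constant maps consists of a suspension with a space
attached at each of the two poles. -/
def constCylHomeo (x₀ : X) (y₀ : Y) (z₀ : Z) :
    Glue (.const X z₀) (MapCyl.bot (.const X y₀)) ≃ₜ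
      Wedge2 (Glue.inl (.const Unit (Susp.mk (x₀, 1))) (.const Unit y₀) (Susp.mk (x₀, 0))) z₀ where
  toFun :=
    let p : C(Unit, Susp X) := .const Unit (Susp.mk (x₀, 1))
    let j : C(Unit, Y) := .const Unit y₀
    let q : C(Unit, Glue p j) := .const Unit (Glue.inl p j (Susp.mk (x₀, 0)))
    let k : C(Unit, Z) := .const Unit z₀
    Glue.desc (f := .const X z₀) (i := MapCyl.bot (.const X y₀)) (Glue.inr q k)
      ((Glue.inl q k).comp (Glue.desc (f := .const X y₀) (i := level 1) (Glue.inr p j)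
        ((Glue.inl p j).comp Susp.mk) fun x =>
          (Glue.condition (f := p) (i := j) ()).symm.trans
            (congrArg (Glue.inl p j) (Susp.mk_one x₀ x))))
      fun x => (Glue.condition (f := q) (i := k) ()).symm.trans
        (congrArg (fun w => Glue.inl q k (Glue.inl p j w)) (Susp.mk_zero x₀ x))
  invFun := Glue.desc
    (Glue.desc (Susp.desc ((Glue.inr _ _).comp (Glue.inr _ _))
        (fun x y => (Glue.condition x).symm.trans (Glue.condition y))
        fun x y => congrArg (Glue.inr _ _) ((Glue.condition x).symm.trans (Glue.condition y)))
      ((Glue.inr _ _).comp (Glue.inl _ _))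
      fun _ => (congrArg (Glue.inr _ _) (Glue.condition x₀)).symm)
    (Glue.inl _ _)
    fun _ => (Glue.condition x₀).symm
  left_inv := Glue.ind (fun _ => rfl) (Glue.ind (fun _ => rfl) fun _ => rfl)
  right_inv := Glue.ind (Glue.ind (Susp.ind fun _ _ => rfl) fun _ => rfl) fun _ => rfl
  continuous_toFun := ContinuousMap.continuous _
  continuous_invFun := ContinuousMap.continuous _

/-- A suspension with spaces attached at its two poles is a wedge with any space homotopy
equivalent to the suspension. -/
lemma constCyl_equiv_wedge3 {W : Type} [TopologicalSpace W] (x₀ : X) {y₀ : Y} {z₀ : Z}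
    (hy : HasHEP (.const Unit y₀)) (hz : HasHEP (.const Unit z₀)) {h : C(Susp X, W)}
    (hh : IsHomotopyEquiv h) :
    Nonempty (ContinuousMap.HomotopyEquiv (Glue (.const X z₀) (MapCyl.bot (.const X y₀)))
      (Wedge3 W Y Z (h (Susp.mk (x₀, 1))) y₀ z₀)) := by
  let f : C(Unit, Susp X) := .const Unit (Susp.mk (x₀, 1))
  have hjoin : Joined (Glue.inl f (.const Unit y₀) (Susp.mk (x₀, 0)))
      (Glue.inl f (.const Unit y₀) (Susp.mk (x₀, 1))) :=
    (Susp.joined_pole x₀ _).symm.map (ContinuousMap.continuous _)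
  obtain ⟨e⟩ := hz.glue_equiv_of_homotopic (hjoin.const_homotopic (E := Unit))
  obtain ⟨e'⟩ := (hz.isHomotopyEquiv_mapLeft
    (.const Unit (Glue.inl f (.const Unit y₀) (Susp.mk (x₀, 1))))
    (hy.isHomotopyEquiv_mapLeft f hh)).nonempty
  exact ⟨((constCylHomeo x₀ y₀ z₀).toHomotopyEquiv.trans e).trans
    (e'.trans (wedge3Homeo (h (Susp.mk (x₀, 1))) y₀ z₀).toHomotopyEquiv)⟩

end Wedge

/-- The pushout along two null-homotopic maps, one of which is well behaved, only depends on the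
homotopy types of the spaces involved. -/
lemma glue_equiv_constCyl {X Y C S T : Type} [TopologicalSpace X] [TopologicalSpace Y]
    [TopologicalSpace C] [TopologicalSpace S] [TopologicalSpace T] {f : C(C, X)} {i : C(C, Y)}
    (hi : HasHEP i) {α : C(X, S)} (hα : IsHomotopyEquiv α) {β : C(Y, T)} (hβ : IsHomotopyEquiv β)
    {y₀ : S} {z₀ : T} (hf : (α.comp f).Homotopic (.const C y₀))
    (hg : (β.comp i).Homotopic (.const C z₀)) :
    Nonempty (ContinuousMap.HomotopyEquiv (Glue f i)
      (Glue (.const C z₀) (MapCyl.bot (.const C y₀)))) := by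
  let k : C(C, S) := .const C y₀
  obtain ⟨e₁⟩ := (hi.isHomotopyEquiv_mapLeft f hα).nonempty
  obtain ⟨e₂⟩ := hi.glue_equiv_of_homotopic hf
  obtain ⟨e₃⟩ := (hi.isHomotopyEquiv_mapLeft (MapCyl.bot k)
    (MapCyl.isHomotopyEquiv_proj k)).nonempty
  obtain ⟨e₄⟩ := ((MapCyl.hasHEP_bot k).isHomotopyEquiv_mapLeft i hβ).nonempty
  obtain ⟨e₅⟩ := (MapCyl.hasHEP_bot k).glue_equiv_of_homotopic hg
  exact ⟨((e₁.trans e₂).trans e₃.symm).trans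
    (((Glue.flip (MapCyl.bot k) i).toHomotopyEquiv.trans e₄).trans e₅)⟩

/-- if `A`, `B` are subcomplexes of a finite simplicial complex with `A ∩ B`
nonempty, `|A| ≃ S^n ≃ |B|`, `|A ∩ B| ≃ S^r` with `r < n`, and both inclusions
`|A ∩ B| ↪ |A|`, `|A ∩ B| ↪ |B|` are homotopic to constant maps, then
`|A ∪ B| ≃ S^(r+1) ∨ S^n ∨ S^n`. -/
theorem realization_union_homotopyEquiv_wedge_of_spheres
    {V : Type} [Fintype V] [DecidableEq V]
    (K A B : Finset (Finset V)) (hK : IsComplex K) (hA : IsComplex A) (hB : IsComplex B)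
    (hAK : A ⊆ K) (hBK : B ⊆ K) (hne : (A ∩ B).Nonempty)
    (n r : ℕ) (hrn : r < n)
    (hSA : Nonempty (ContinuousMap.HomotopyEquiv (↥(realization A)) (NSphere n)))
    (hSB : Nonempty (ContinuousMap.HomotopyEquiv (↥(realization B)) (NSphere n)))
    (hSAB : Nonempty (ContinuousMap.HomotopyEquiv (↥(realization (A ∩ B))) (NSphere r)))
    (hconstA : ∃ a : ↥(realization A),
      (inclMap (Finset.inter_subset_left : A ∩ B ⊆ A)).Homotopic (ContinuousMap.const _ a))
    (hconstB : ∃ b : ↥(realization B),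
      (inclMap (Finset.inter_subset_right : A ∩ B ⊆ B)).Homotopic (ContinuousMap.const _ b)) :
    ∃ (p : NSphere (r + 1)) (q₁ q₂ : NSphere n),
      Nonempty (ContinuousMap.HomotopyEquiv (↥(realization (A ∪ B)))
        (Wedge3 (NSphere (r + 1)) (NSphere n) (NSphere n) p q₁ q₂)) := by
  obtain ⟨α⟩ := hSA
  obtain ⟨β⟩ := hSB
  obtain ⟨γ⟩ := hSAB
  obtain ⟨a, ha⟩ := hconstA
  obtain ⟨b, hb⟩ := hconstB
  obtain ⟨m, rfl⟩ : ∃ m, n = m + 1 := ⟨n - 1, by omega⟩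
  obtain ⟨q, hq, hjoin⟩ := exists_sphere_pole m
  have hAB : IsComplex (A ∩ B) := fun s hs =>
    have hs' := mem_inter.1 hs
    ⟨(hA s hs'.1).1, fun t hts ht =>
      mem_inter.2 ⟨(hA s hs'.1).2 t hts ht, (hB s hs'.2).2 t hts ht⟩⟩
  have hnull {C X : Type} [TopologicalSpace C] [TopologicalSpace X] {f : C(C, X)} {x : X}
      (hf : f.Homotopic (.const C x)) (φ : C(X, NSphere (m + 1))) :
      (φ.comp f).Homotopic (.const C q) :=
    ((Homotopic.refl φ).comp hf).trans (hjoin (φ x)).const_homotopic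
  obtain ⟨e₁⟩ := nonempty_homeomorph_glue_union hA hB
  obtain ⟨e₂⟩ := glue_equiv_constCyl (hasHEP_inclMap hAB hB inter_subset_right)
    α.isHomotopyEquiv β.isHomotopyEquiv (hnull ha α.toFun) (hnull hb β.toFun)
  let x₀ : realization (A ∩ B) := γ.invFun (Classical.arbitrary _)
  obtain ⟨e₃⟩ := constCyl_equiv_wedge3 x₀ hq hq
    ((suspHomeoSphere r).toHomotopyEquiv.isHomotopyEquiv.comp
      (Susp.isHomotopyEquiv_map γ.isHomotopyEquiv))
  exact ⟨_, q, q, ⟨(e₁.symm.toHomotopyEquiv.trans e₂).trans e₃⟩⟩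
end

section
/- For every n ≥ 3, the maximum cardinality of a Morse matching on the cycle graph C_n on n nodes is n − 1; equivalently, the pure discrete Morse complex of C_n has dimension n − 2. -/
open Finset

/-- Arc of the Hasse diagram of the simplicial complex `K`: from `g` to `f` whenever
`f ⊂ g` and `dim g = dim f + 1`. -/
def HasseArc {V : Type} [DecidableEq V] (K : Finset (Finset V)) (g f : Finset V) : Prop :=
  g ∈ K ∧ f ∈ K ∧ f ⊂ g ∧ g.card = f.card + 1

/-- `M` is a matching: no two distinct pairs of `M` share an endpoint. -/
def IsMatchingPairs {α : Type} (M : Set (α × α)) : Prop :=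
  ∀ p ∈ M, ∀ q ∈ M, p ≠ q → p.1 ≠ q.1 ∧ p.1 ≠ q.2 ∧ p.2 ≠ q.1 ∧ p.2 ≠ q.2

/-- One step of the Hasse diagram of `K` with the arcs belonging to `M` reversed. -/
def MorseStep {V : Type} [DecidableEq V] (K : Finset (Finset V))
    (M : Set (Finset V × Finset V)) (x y : Finset V) : Prop :=
  (HasseArc K x y ∧ (x, y) ∉ M) ∨ ((y, x) ∈ M ∧ HasseArc K y x)

/-- A (discrete) Morse matching on the complex `K`: a matching in the Hasse diagram of `K`
such that reversing exactly the arcs of the matching yields a directed graph with no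
directed cycle. -/
def IsMorseMatching {V : Type} [DecidableEq V] (K : Finset (Finset V))
    (M : Set (Finset V × Finset V)) : Prop :=
  (∀ p ∈ M, HasseArc K p.1 p.2) ∧ IsMatchingPairs M ∧
    ∀ s : Finset V, ¬ Relation.TransGen (MorseStep K M) s s

/-- A finite graph regarded as a one-dimensional simplicial complex: faces are the
vertices (as singletons) and the edges (as two-element sets). -/
noncomputable def graphComplex {V : Type} [Fintype V] [DecidableEq V] (G : SimpleGraph V) :
    Finset (Finset V) := by
  classical
  exact Finset.univ.filter fun s => (∃ v, s = {v}) ∨ ∃ u v, G.Adj u v ∧ s = {u, v}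

/-- Arcs of the Hasse diagram of a graph go from an edge to one of its endpoints. -/
lemma hasseArc_graphComplex_iff {V : Type} [Fintype V] [DecidableEq V] (G : SimpleGraph V)
    (g f : Finset V) :
    HasseArc (graphComplex G) g f ↔ ∃ u v, G.Adj u v ∧ g = {u, v} ∧ f = {u} := by
  simp only [HasseArc, graphComplex, Finset.mem_filter, Finset.mem_univ, true_and]
  constructor
  · rintro ⟨hg, hf, hfg, hcard⟩
    have hf_pos : 0 < f.card := by
      rcases hf with ⟨w, rfl⟩ | ⟨u, v, -, rfl⟩ <;> simp
    obtain ⟨u, v, huv, rfl⟩ : ∃ u v, G.Adj u v ∧ g = {u, v} := by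
      rcases hg with ⟨w, rfl⟩ | h
      · rw [Finset.card_singleton] at hcard
        omega
      · exact h
    rw [Finset.card_pair huv.ne] at hcard
    obtain ⟨w, rfl⟩ := Finset.card_eq_one.mp (show f.card = 1 by omega)
    have hw := hfg.subset (Finset.mem_singleton_self w)
    rcases Finset.mem_insert.mp hw with rfl | hw
    · exact ⟨w, v, huv, rfl, rfl⟩
    · rw [Finset.mem_singleton] at hw
      subst hw
      exact ⟨w, u, huv.symm, Finset.pair_comm _ _, rfl⟩
  · rintro ⟨u, v, huv, rfl, rfl⟩
    refine ⟨Or.inr ⟨u, v, huv, rfl⟩, Or.inl ⟨u, rfl⟩, ?_, ?_⟩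
    · refine Finset.ssubset_iff_subset_ne.mpr ⟨by simp, fun h => ?_⟩
      have := congrArg Finset.card h
      simp [Finset.card_pair huv.ne] at this
    · simp [Finset.card_pair huv.ne]

/-- A Morse matching on a nonempty graph leaves some node unmatched. -/
lemma IsMorseMatching.exists_unmatched_node {V : Type} [Fintype V] [DecidableEq V] [Nonempty V]
    {G : SimpleGraph V} {M : Set (Finset V × Finset V)}
    (hM : IsMorseMatching (graphComplex G) M) : ∃ v : V, ∀ e, (e, {v}) ∉ M := by
  obtain ⟨harc, hmatch, hacyc⟩ := hM
  let R : V → V → Prop := fun w v => Relation.TransGen (MorseStep (graphComplex G) M) {v} {w}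
  have : IsTrans V R := ⟨fun _ _ _ hab hbc => hbc.trans hab⟩
  have : Std.Irrefl R := ⟨fun v hv => hacyc {v} hv⟩
  obtain ⟨v, -, hv⟩ := (Finite.wellFounded_of_trans_of_irrefl R).has_min Set.univ Set.univ_nonempty
  refine ⟨v, fun e he => ?_⟩
  obtain ⟨u, w, huw, rfl, hu⟩ := (hasseArc_graphComplex_iff G _ _).mp (harc _ he)
  obtain rfl : v = u := Finset.singleton_injective hu
  have hup : MorseStep (graphComplex G) M {v} {v, w} := Or.inr ⟨he, harc _ he⟩
  have hdown : MorseStep (graphComplex G) M {v, w} {w} :=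
    Or.inl ⟨(hasseArc_graphComplex_iff G _ _).mpr ⟨w, v, huw.symm, Finset.pair_comm _ _, rfl⟩,
      fun hw => (hmatch _ he _ hw (by simpa using huw.ne)).1 rfl⟩
  exact hv w (Set.mem_univ w) ((Relation.TransGen.single hup).tail hdown)

/-- A Morse matching on a nonempty graph has fewer pairs than the graph has nodes. -/
lemma IsMorseMatching.card_lt_card_nodes {V : Type} [Fintype V] [DecidableEq V] [Nonempty V]
    {G : SimpleGraph V} {M : Finset (Finset V × Finset V)}
    (hM : IsMorseMatching (graphComplex G) (M : Set (Finset V × Finset V))) :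
    M.card < Fintype.card V := by
  obtain ⟨v, hv⟩ := hM.exists_unmatched_node
  have hinj : Set.InjOn Prod.snd (M : Set (Finset V × Finset V)) := fun p hp q hq hpq => by
    by_contra hne
    exact (hM.2.1 p hp q hq hne).2.2.2 hpq
  have hsub : M.image Prod.snd ⊆ (Finset.univ.erase v).image fun w => ({w} : Finset V) := by
    intro f hf
    obtain ⟨p, hp, rfl⟩ := Finset.mem_image.mp hf
    obtain ⟨u, w, -, -, hu⟩ := (hasseArc_graphComplex_iff G _ _).mp (hM.1 p hp)
    refine Finset.mem_image.mpr ⟨u, Finset.mem_erase.mpr ⟨?_, Finset.mem_univ u⟩, hu.symm⟩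
    rintro rfl
    exact hv p.1 (by rw [← hu]; exact hp)
  calc M.card = (M.image Prod.snd).card := (Finset.card_image_of_injOn hinj).symm
    _ ≤ _ := Finset.card_le_card hsub
    _ ≤ (Finset.univ.erase v).card := Finset.card_image_le
    _ < Fintype.card V := Finset.card_erase_lt_of_mem (Finset.mem_univ v)

/-- If the steps strictly decrease some rank, the modified Hasse diagram is acyclic. -/
lemma not_transGen_self_of_rank {α : Type} {r : α → α → Prop} (φ : α → ℕ)
    (hφ : ∀ x y, r x y → φ y < φ x) (s : α) : ¬ Relation.TransGen r s s := by
  have h : ∀ x y, Relation.TransGen r x y → φ y < φ x := fun x y hxy => by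
    induction hxy with
    | single h => exact hφ _ _ h
    | tail _ h ih => exact (hφ _ _ h).trans ih
  exact fun hs => (h s s hs).false

/-- Adjacent nodes of a cycle are consecutive or the two ends of the path `0, …, m`. -/
lemma cycleGraph_adj_cases {m : ℕ} {u v : Fin (m + 1)}
    (h : (SimpleGraph.cycleGraph (m + 1)).Adj u v) :
    u.val + 1 = v.val ∨ v.val + 1 = u.val ∨ (u = 0 ∧ v = Fin.last m) ∨
      (u = Fin.last m ∧ v = 0) := by
  rw [SimpleGraph.cycleGraph_adj'] at h
  simp only [Fin.ext_iff, Fin.val_zero, Fin.val_last]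
  have := u.isLt
  have := v.isLt
  rcases le_total u v with huv | huv <;> rcases eq_or_ne u v with rfl | hne
  · simp at h
  · have hlt := lt_of_le_of_ne huv hne
    rw [Fin.coe_sub_iff_lt.mpr hlt, Fin.coe_sub_iff_le.mpr huv] at h
    omega
  · simp at h
  · have hlt := lt_of_le_of_ne huv hne.symm
    rw [Fin.coe_sub_iff_lt.mpr hlt, Fin.coe_sub_iff_le.mpr huv] at h
    omega

/-- The matching pairing each node `i + 1` with the edge `{i, i + 1}`. -/
def pathMatching (m : ℕ) : Finset (Finset (Fin (m + 1)) × Finset (Fin (m + 1))) :=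
  Finset.univ.image fun i : Fin m => ({i.succ, i.castSucc}, {i.succ})

lemma mem_pathMatching_iff {m : ℕ} {p : Finset (Fin (m + 1)) × Finset (Fin (m + 1))} :
    p ∈ pathMatching m ↔ ∃ u v : Fin (m + 1), v.val + 1 = u.val ∧ p = ({u, v}, {u}) := by
  simp only [pathMatching, Finset.mem_image, Finset.mem_univ, true_and]
  constructor
  · rintro ⟨i, rfl⟩
    exact ⟨i.succ, i.castSucc, by simp, rfl⟩
  · rintro ⟨u, v, huv, rfl⟩
    have hv : v.val < m := by omega
    refine ⟨⟨v.val, hv⟩, ?_⟩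
    obtain rfl : u = Fin.succ ⟨v.val, hv⟩ := Fin.ext (by simp [huv])
    rfl

lemma card_pathMatching (m : ℕ) : (pathMatching m).card = m := by
  rw [pathMatching, Finset.card_image_of_injective _ fun i j h => ?_, Finset.card_univ,
    Fintype.card_fin]
  exact Fin.succ_injective _ (Finset.singleton_injective (Prod.ext_iff.mp h).2)

/-- A rank on the faces of the cycle that strictly decreases along the steps
determined by `pathMatching`. -/
def pathRank (m : ℕ) (s : Finset (Fin (m + 1))) : ℕ :=
  if s = {0, Fin.last m} then 2 * m + 1
  else if s.card = 1 then 2 * ∑ x ∈ s, x.val else ∑ x ∈ s, x.val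

lemma pathRank_singleton {m : ℕ} (hm : 2 ≤ m) (u : Fin (m + 1)) :
    pathRank m {u} = 2 * u.val := by
  have h : ({u} : Finset (Fin (m + 1))) ≠ {0, Fin.last m} := fun h => by
    have := congrArg Finset.card h
    rw [Finset.card_pair (by simp [Fin.ext_iff]; omega)] at this
    simp at this
  simp [pathRank, h]

lemma pathRank_pair {m : ℕ} (hm : 2 ≤ m) {u v : Fin (m + 1)} (huv : v.val + 1 = u.val) :
    pathRank m {u, v} = u.val + v.val := by
  have hne : u ≠ v := by rintro rfl; omega
  have h : ({u, v} : Finset (Fin (m + 1))) ≠ {0, Fin.last m} := fun h => by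
    have h0 : (0 : Fin (m + 1)) ∈ ({u, v} : Finset _) := by simp [h]
    have hl : Fin.last m ∈ ({u, v} : Finset _) := by simp [h]
    simp only [Finset.mem_insert, Finset.mem_singleton, Fin.ext_iff, Fin.val_zero,
      Fin.val_last] at h0 hl
    omega
  rw [pathRank, if_neg h, if_neg (by simp [Finset.card_pair hne]), Finset.sum_pair hne]

lemma pathRank_lt_of_morseStep {m : ℕ} (hm : 2 ≤ m) {x y : Finset (Fin (m + 1))}
    (h : MorseStep (graphComplex (SimpleGraph.cycleGraph (m + 1))) (pathMatching m) x y) :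
    pathRank m y < pathRank m x := by
  rcases h with ⟨harc, hnot⟩ | ⟨hmem, -⟩
  · obtain ⟨u, v, huv, rfl, rfl⟩ := (hasseArc_graphComplex_iff _ _ _).mp harc
    rw [pathRank_singleton hm]
    rcases cycleGraph_adj_cases huv with h | h | ⟨rfl, rfl⟩ | ⟨rfl, rfl⟩
    · rw [Finset.pair_comm, pathRank_pair hm h]
      omega
    · exact absurd (Finset.mem_coe.mpr (mem_pathMatching_iff.mpr ⟨u, v, h, rfl⟩)) hnot
    · simp [pathRank]
    · simp [pathRank, Finset.pair_comm]
  · obtain ⟨u, v, huv, h⟩ := mem_pathMatching_iff.mp (Finset.mem_coe.mp hmem)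
    obtain ⟨rfl, rfl⟩ := Prod.mk.inj h
    rw [pathRank_singleton hm, pathRank_pair hm huv]
    omega

lemma isMorseMatching_pathMatching {m : ℕ} (hm : 2 ≤ m) :
    IsMorseMatching (graphComplex (SimpleGraph.cycleGraph (m + 1)))
      (pathMatching m : Set (Finset (Fin (m + 1)) × Finset (Fin (m + 1)))) := by
  refine ⟨fun p hp => ?_, fun p hp q hq hpq => ?_,
    not_transGen_self_of_rank (pathRank m) fun _ _ => pathRank_lt_of_morseStep hm⟩
  · obtain ⟨u, v, huv, rfl⟩ := mem_pathMatching_iff.mp (Finset.mem_coe.mp hp)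
    refine (hasseArc_graphComplex_iff _ _ _).mpr ⟨u, v, ?_, rfl, rfl⟩
    rw [SimpleGraph.cycleGraph_adj']
    left
    rw [Fin.coe_sub_iff_le.mpr (Fin.le_def.mpr (by omega))]
    omega
  · obtain ⟨u, v, huv, rfl⟩ := mem_pathMatching_iff.mp (Finset.mem_coe.mp hp)
    obtain ⟨a, b, hab, rfl⟩ := mem_pathMatching_iff.mp (Finset.mem_coe.mp hq)
    have hua : u ≠ a := by
      rintro rfl
      obtain rfl : v = b := Fin.ext (by omega)
      exact hpq rfl
    have huv_ne : u ≠ v := by rintro rfl; omega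
    have hab_ne : a ≠ b := by rintro rfl; omega
    have pair_ne_singleton : ∀ {x y z : Fin (m + 1)}, x ≠ y →
        ({x, y} : Finset (Fin (m + 1))) ≠ {z} := fun hxy h => by
      have := congrArg Finset.card h
      simp [Finset.card_pair hxy] at this
    refine ⟨fun h => hua (Fin.ext ?_), pair_ne_singleton huv_ne,
      (pair_ne_singleton hab_ne).symm, by simpa using hua⟩
    have hsum := congrArg (pathRank m) h
    dsimp only at hsum
    rw [pathRank_pair hm huv, pathRank_pair hm hab] at hsum
    omega

/-- for `n ≥ 3`, the maximum cardinality of a Morse matching on the cycle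
graph `C_n` is `n - 1` (equivalently, the pure discrete Morse complex of `C_n` has
dimension `n - 2`). -/
theorem max_card_morse_matching_cycle (n : ℕ) (hn : 3 ≤ n) :
    IsGreatest {k : ℕ | ∃ M : Finset (Finset (Fin n) × Finset (Fin n)),
      IsMorseMatching (graphComplex (SimpleGraph.cycleGraph n)) ↑M ∧ M.card = k} (n - 1) := by
  obtain ⟨m, rfl⟩ : ∃ m, n = m + 1 := ⟨n - 1, by omega⟩
  refine ⟨⟨pathMatching m, isMorseMatching_pathMatching (by omega), card_pathMatching m⟩, ?_⟩
  rintro k ⟨M, hM, rfl⟩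
  have := hM.card_lt_card_nodes
  rw [Fintype.card_fin] at this
  omega
end

section
/- For n ≥ 3, the discrete Morse complex M(C_n) of the cycle graph C_n is pure (all maximal faces have the same dimension) if and only if n ≤ 5; equivalently, every inclusion-maximal Morse matching on C_n has cardinality n − 1 if and only if n ≤ 5. -/
open Finset

namespace CycleMorse

variable {m : ℕ}

/-- The edge `{i, i + 1}` of the cycle. -/
def edge (i : Fin (m + 3)) : Finset (Fin (m + 3)) := {i, i + 1}

/-- The Hasse arcs `({i, i + 1}, {i})` for `i ∈ A` and `({i, i + 1}, {i + 1})` for `i ∈ B`. -/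
def arcs (A B : Finset (Fin (m + 3))) : Finset (Finset (Fin (m + 3)) × Finset (Fin (m + 3))) :=
  A.image (fun i => (edge i, {i})) ∪ B.image (fun i => (edge i, {i + 1}))

/-- The combinatorial condition on `A` and `B` for `arcs A B` to be a Morse matching. -/
structure Admissible (A B : Finset (Fin (m + 3))) : Prop where
  edge_disjoint : ∀ i ∈ A, i ∉ B
  node_disjoint : ∀ i, i + 1 ∈ A → i ∉ B
  left_ne_univ : A ≠ univ
  right_ne_univ : B ≠ univ

theorem one_add_one_ne_zero_fin : (1 + 1 : Fin (m + 3)) ≠ 0 := by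
  intro h
  have := congrArg Fin.val h
  rw [Fin.val_add] at this
  simp [Nat.mod_eq_of_lt] at this

theorem add_one_ne_self (i : Fin (m + 3)) : i + 1 ≠ i := by
  simp

theorem edge_injective : Function.Injective (edge (m := m)) := by
  intro i j h
  have hi : i ∈ edge j := h ▸ by simp [edge]
  have hi' : i + 1 ∈ edge j := h ▸ by simp [edge]
  simp only [edge, mem_insert, mem_singleton] at hi hi'
  rcases hi with hi | rfl
  · exact hi
  · rcases hi' with h' | h'
    · rw [add_assoc, add_eq_left] at h'
      exact absurd h' one_add_one_ne_zero_fin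
    · exact absurd h' (add_one_ne_self _)

theorem edge_ne_singleton (i j : Fin (m + 3)) : edge i ≠ {j} := by
  intro h
  have := congrArg Finset.card h
  rw [edge, card_pair (add_one_ne_self i).symm, card_singleton] at this
  omega

theorem mem_graphComplex_iff (s : Finset (Fin (m + 3))) :
    s ∈ graphComplex (SimpleGraph.cycleGraph (m + 3)) ↔ (∃ v, s = {v}) ∨ ∃ i, s = edge i := by
  simp only [graphComplex, mem_filter, mem_univ, true_and, SimpleGraph.cycleGraph_adj, edge]
  refine or_congr_right ⟨?_, ?_⟩
  · rintro ⟨u, v, h | h, rfl⟩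
    · exact ⟨v, by rw [← h, add_sub_cancel, pair_comm]⟩
    · exact ⟨u, by rw [← h, add_sub_cancel]⟩
  · rintro ⟨i, rfl⟩
    exact ⟨i, i + 1, Or.inr (by simp), rfl⟩

theorem hasseArc_iff (g f : Finset (Fin (m + 3))) :
    HasseArc (graphComplex (SimpleGraph.cycleGraph (m + 3))) g f ↔
      ∃ i, g = edge i ∧ (f = {i} ∨ f = {i + 1}) := by
  have hcard (i : Fin (m + 3)) : (edge i).card = 2 := card_pair (add_one_ne_self i).symm
  simp only [HasseArc, mem_graphComplex_iff]
  constructor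
  · rintro ⟨⟨v, rfl⟩ | ⟨i, rfl⟩, ⟨w, rfl⟩ | ⟨j, rfl⟩, hsub, hc⟩
    · simp at hc
    · simp [hcard] at hc
    · refine ⟨i, rfl, ?_⟩
      have := hsub.1 (mem_singleton_self w)
      simpa [edge] using this
    · simp [hcard] at hc
  · rintro ⟨i, rfl, rfl | rfl⟩
    · refine ⟨.inr ⟨i, rfl⟩, .inl ⟨i, rfl⟩, ?_, by simp [hcard]⟩
      exact Finset.ssubset_iff_subset_ne.2 ⟨by simp [edge], (edge_ne_singleton _ _).symm⟩
    · refine ⟨.inr ⟨i, rfl⟩, .inl ⟨i + 1, rfl⟩, ?_, by simp [hcard]⟩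
      exact Finset.ssubset_iff_subset_ne.2 ⟨by simp [edge], (edge_ne_singleton _ _).symm⟩

theorem mk_mem_arcs_left {A B : Finset (Fin (m + 3))} {i : Fin (m + 3)} :
    (edge i, {i}) ∈ arcs A B ↔ i ∈ A := by
  simp only [arcs, mem_union, mem_image, Prod.mk.injEq, edge_injective.eq_iff, singleton_inj]
  constructor
  · rintro (⟨j, hj, rfl, -⟩ | ⟨j, -, rfl, h⟩)
    · exact hj
    · exact absurd h (add_one_ne_self _)
  · exact fun h => .inl ⟨i, h, rfl, rfl⟩

theorem mk_mem_arcs_right {A B : Finset (Fin (m + 3))} {i : Fin (m + 3)} :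
    (edge i, {i + 1}) ∈ arcs A B ↔ i ∈ B := by
  simp only [arcs, mem_union, mem_image, Prod.mk.injEq, edge_injective.eq_iff, singleton_inj]
  constructor
  · rintro (⟨j, -, rfl, h⟩ | ⟨j, hj, rfl, -⟩)
    · exact absurd h.symm (add_one_ne_self _)
    · exact hj
  · exact fun h => .inr ⟨i, h, rfl, rfl⟩

theorem arcs_subset_iff {A B A' B' : Finset (Fin (m + 3))} :
    arcs A B ⊆ arcs A' B' ↔ A ⊆ A' ∧ B ⊆ B' := by
  constructor
  · intro h
    exact ⟨fun i hi => mk_mem_arcs_left.1 (h (mk_mem_arcs_left.2 hi)),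
      fun i hi => mk_mem_arcs_right.1 (h (mk_mem_arcs_right.2 hi))⟩
  · rintro ⟨hA, hB⟩
    exact union_subset_union (image_subset_image hA) (image_subset_image hB)

theorem card_arcs (A B : Finset (Fin (m + 3))) : (arcs A B).card = A.card + B.card := by
  rw [arcs, card_union_of_disjoint, card_image_of_injective, card_image_of_injective]
  · exact fun i j h => edge_injective (Prod.ext_iff.1 h).1
  · exact fun i j h => edge_injective (Prod.ext_iff.1 h).1
  · rw [disjoint_left]
    simp only [mem_image, not_exists, not_and]
    rintro _ ⟨i, -, rfl⟩ j - h
    rw [Prod.mk.injEq, edge_injective.eq_iff, singleton_inj] at h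
    obtain ⟨rfl, h⟩ := h
    exact add_one_ne_self _ h

theorem exists_eq_arcs {M : Finset (Finset (Fin (m + 3)) × Finset (Fin (m + 3)))}
    (hM : ∀ p ∈ M, HasseArc (graphComplex (SimpleGraph.cycleGraph (m + 3))) p.1 p.2) :
    ∃ A B, M = arcs A B := by
  refine ⟨univ.filter fun i => (edge i, {i}) ∈ M, univ.filter fun i => (edge i, {i + 1}) ∈ M, ?_⟩
  ext ⟨g, f⟩
  constructor
  · intro h
    obtain ⟨i, hg, hf | hf⟩ := (hasseArc_iff _ _).1 (hM _ h) <;> dsimp only at hg hf <;> subst hg hf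
    · simpa [mk_mem_arcs_left] using h
    · simpa [mk_mem_arcs_right] using h
  · simp only [arcs, mem_union, mem_image, mem_filter, mem_univ, true_and]
    rintro (⟨i, h, h'⟩ | ⟨i, h, h'⟩) <;> rwa [← h']

/-- A nonempty set of elements of a cycle that is closed under successors is everything. -/
theorem forall_of_add_one {P : Fin (m + 3) → Prop} {i : Fin (m + 3)} (hi : P i)
    (h : ∀ j, P j → P (j + 1)) (j : Fin (m + 3)) : P j := by
  have key (k : ℕ) : P (i + Fin.ofNat (m + 3) k) := by
    induction k with
    | zero => simpa using hi
    | succ k ih =>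
      have := h _ ih
      rwa [add_assoc, show Fin.ofNat (m + 3) k + 1 = Fin.ofNat (m + 3) (k + 1) by
        simp [Fin.ext_iff, Fin.val_add]] at this
  have := key (j - i).val
  simpa using this

theorem forall_of_sub_one {P : Fin (m + 3) → Prop} {i : Fin (m + 3)} (hi : P i)
    (h : ∀ j, P (j + 1) → P j) (j : Fin (m + 3)) : P j := by
  have := forall_of_add_one (P := fun j => P (-j)) (i := -i) (by simpa using hi)
    (fun j hj => h _ (by simpa using hj)) (-j)
  simpa using this

theorem exists_step_of_transGen {α : Type*} {r : α → α → Prop} {x : α}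
    (h : Relation.TransGen r x x) : ∃ y, r x y ∧ Relation.TransGen r y y := by
  obtain ⟨y, hxy, hyx⟩ := Relation.TransGen.head'_iff.1 h
  exact ⟨y, hxy, Relation.TransGen.tail'_iff.2 ⟨x, hyx, hxy⟩⟩

/-- The faces of the cycle that lie on a directed cycle of the modified Hasse diagram. -/
def Recurrent (A B : Finset (Fin (m + 3))) (s : Finset (Fin (m + 3))) : Prop :=
  Relation.TransGen
    (MorseStep (graphComplex (SimpleGraph.cycleGraph (m + 3))) (arcs A B : Set _)) s s

theorem morseStep_singleton_iff {A B : Finset (Fin (m + 3))} {i : Fin (m + 3)}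
    {s : Finset (Fin (m + 3))} :
    MorseStep (graphComplex (SimpleGraph.cycleGraph (m + 3))) (arcs A B : Set _) {i} s ↔
      (i ∈ A ∧ s = edge i) ∨ ∃ j ∈ B, j + 1 = i ∧ s = edge j := by
  simp only [MorseStep, hasseArc_iff, mem_coe]
  constructor
  · rintro (⟨⟨j, h, -⟩, -⟩ | ⟨hM, j, rfl, h | h⟩)
    · exact absurd h.symm (edge_ne_singleton _ _)
    · rw [singleton_inj] at h
      subst h
      exact .inl ⟨mk_mem_arcs_left.1 hM, rfl⟩
    · rw [singleton_inj] at h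
      subst h
      exact .inr ⟨j, mk_mem_arcs_right.1 hM, rfl, rfl⟩
  · rintro (⟨h, rfl⟩ | ⟨j, h, rfl, rfl⟩)
    · exact .inr ⟨mk_mem_arcs_left.2 h, i, rfl, .inl rfl⟩
    · exact .inr ⟨mk_mem_arcs_right.2 h, j, rfl, .inr rfl⟩

theorem morseStep_edge_iff {A B : Finset (Fin (m + 3))} {i : Fin (m + 3)}
    {s : Finset (Fin (m + 3))} :
    MorseStep (graphComplex (SimpleGraph.cycleGraph (m + 3))) (arcs A B : Set _) (edge i) s ↔
      (i ∉ A ∧ s = {i}) ∨ (i ∉ B ∧ s = {i + 1}) := by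
  simp only [MorseStep, hasseArc_iff, mem_coe]
  constructor
  · rintro (⟨⟨j, h, h' | h'⟩, hM⟩ | ⟨-, j, -, h | h⟩)
    · obtain rfl := edge_injective h
      subst h'
      exact .inl ⟨mt mk_mem_arcs_left.2 hM, rfl⟩
    · obtain rfl := edge_injective h
      subst h'
      exact .inr ⟨mt mk_mem_arcs_right.2 hM, rfl⟩
    · exact absurd h (edge_ne_singleton _ _)
    · exact absurd h (edge_ne_singleton _ _)
  · rintro (⟨h, rfl⟩ | ⟨h, rfl⟩)
    · exact .inl ⟨⟨i, rfl, .inl rfl⟩, mt mk_mem_arcs_left.1 h⟩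
    · exact .inl ⟨⟨i, rfl, .inr rfl⟩, mt mk_mem_arcs_right.1 h⟩

theorem Recurrent.exists_singleton {A B : Finset (Fin (m + 3))} {s : Finset (Fin (m + 3))}
    (h : Recurrent A B s) : ∃ i, Recurrent A B {i} := by
  obtain ⟨t, hst, ht⟩ := exists_step_of_transGen h
  have hs : (∃ v, s = {v}) ∨ ∃ i, s = edge i := by
    rw [← mem_graphComplex_iff]
    rcases hst with ⟨h, -⟩ | ⟨-, h⟩
    exacts [h.1, h.2.1]
  rcases hs with ⟨v, rfl⟩ | ⟨i, rfl⟩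
  · exact ⟨v, h⟩
  · rcases morseStep_edge_iff.1 hst with ⟨-, rfl⟩ | ⟨-, rfl⟩
    exacts [⟨_, ht⟩, ⟨_, ht⟩]

theorem Admissible.not_recurrent {A B : Finset (Fin (m + 3))} (hAB : Admissible A B)
    (s : Finset (Fin (m + 3))) : ¬ Recurrent A B s := by
  intro hs
  obtain ⟨i, hi⟩ := hs.exists_singleton
  have next (j) (hj : Recurrent A B {j}) :
      (j ∈ A ∧ Recurrent A B {j + 1}) ∨ ∃ k ∈ B, k + 1 = j ∧ Recurrent A B {k} := by
    obtain ⟨t, hjt, ht⟩ := exists_step_of_transGen hj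
    rcases morseStep_singleton_iff.1 hjt with ⟨hjA, rfl⟩ | ⟨k, hk, rfl, rfl⟩
    · obtain ⟨t, hjt, ht⟩ := exists_step_of_transGen ht
      rcases morseStep_edge_iff.1 hjt with ⟨h, rfl⟩ | ⟨-, rfl⟩
      · exact absurd hjA h
      · exact .inl ⟨hjA, ht⟩
    · obtain ⟨t, hjt, ht⟩ := exists_step_of_transGen ht
      rcases morseStep_edge_iff.1 hjt with ⟨-, rfl⟩ | ⟨h, rfl⟩
      · exact .inr ⟨k, hk, rfl, ht⟩
      · exact absurd hk h
  rcases next i hi with h | ⟨k, hk⟩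
  · refine hAB.left_ne_univ (eq_univ_iff_forall.2 fun j => ?_)
    refine (forall_of_add_one (P := fun j => j ∈ A ∧ Recurrent A B {j + 1}) h ?_ j).1
    rintro j ⟨hjA, hj⟩
    rcases next _ hj with h | ⟨k, hk, hkj, -⟩
    · exact h
    · rw [add_left_inj] at hkj
      exact absurd (hkj ▸ hk) (hAB.edge_disjoint j hjA)
  · refine hAB.right_ne_univ (eq_univ_iff_forall.2 fun j => ?_)
    refine (forall_of_sub_one (P := fun j => j ∈ B ∧ Recurrent A B {j}) ⟨hk.1, hk.2.2⟩ ?_ j).1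
    rintro j ⟨hjB, hj⟩
    rcases next _ hj with ⟨h, -⟩ | ⟨k, hk, hkj, hk'⟩
    · exact absurd hjB (hAB.edge_disjoint _ h)
    · rw [add_left_inj] at hkj
      exact hkj ▸ ⟨hk, hk'⟩

theorem isMatchingPairs_arcs_iff {A B : Finset (Fin (m + 3))} :
    IsMatchingPairs (arcs A B : Set (Finset (Fin (m + 3)) × Finset (Fin (m + 3)))) ↔
      (∀ i ∈ A, i ∉ B) ∧ ∀ i, i + 1 ∈ A → i ∉ B := by
  constructor
  · refine fun h => ⟨fun i hA hB => ?_, fun i hA hB => ?_⟩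
    · refine (h _ (mk_mem_arcs_left.2 hA) _ (mk_mem_arcs_right.2 hB) ?_).1 rfl
      simp
    · refine (h _ (mk_mem_arcs_left.2 hA) _ (mk_mem_arcs_right.2 hB) ?_).2.2.2 rfl
      simp [edge_injective.eq_iff]
  · rintro ⟨hedge, hnode⟩ p hp q hq hpq
    simp only [arcs, coe_union, coe_image, Set.mem_union, Set.mem_image, mem_coe] at hp hq
    rcases hp with ⟨i, hi, rfl⟩ | ⟨i, hi, rfl⟩ <;> rcases hq with ⟨j, hj, rfl⟩ | ⟨j, hj, rfl⟩ <;>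
      refine ⟨?_, edge_ne_singleton _ _, (edge_ne_singleton _ _).symm, ?_⟩ <;>
      simp only [ne_eq, edge_injective.eq_iff, singleton_inj] <;> rintro h
    · exact hpq (by rw [h])
    · exact hpq (by rw [h])
    · exact hedge _ hi (h ▸ hj)
    · exact hnode _ (h ▸ hi) hj
    · exact hedge _ hj (h ▸ hi)
    · exact hnode _ (h ▸ hj) hi
    · exact hpq (by rw [h])
    · exact hpq (by rw [add_right_cancel h])

theorem isMorseMatching_arcs_iff {A B : Finset (Fin (m + 3))} :
    IsMorseMatching (graphComplex (SimpleGraph.cycleGraph (m + 3)))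
      (arcs A B : Set (Finset (Fin (m + 3)) × Finset (Fin (m + 3)))) ↔ Admissible A B := by
  constructor
  · rintro ⟨-, hmatch, hacyc⟩
    obtain ⟨hedge, hnode⟩ := isMatchingPairs_arcs_iff.1 hmatch
    refine ⟨hedge, hnode, ?_, ?_⟩
    · rintro rfl
      let r := MorseStep (graphComplex (SimpleGraph.cycleGraph (m + 3))) (arcs univ B : Set _)
      have step (i : Fin (m + 3)) : Relation.TransGen r {i} {i + 1} :=
        .tail (.single (morseStep_singleton_iff.2 (.inl ⟨mem_univ i, rfl⟩)))
          (morseStep_edge_iff.2 (.inr ⟨hedge i (mem_univ i), rfl⟩))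
      exact hacyc {0} (forall_of_add_one (P := fun j => Relation.TransGen r {0} {j})
        (step 0) (fun j hj => hj.trans (step j)) 0)
    · rintro rfl
      let r := MorseStep (graphComplex (SimpleGraph.cycleGraph (m + 3))) (arcs A univ : Set _)
      have step (i : Fin (m + 3)) : Relation.TransGen r {i + 1} {i} :=
        .tail (.single (morseStep_singleton_iff.2 (.inr ⟨i, mem_univ i, rfl, rfl⟩)))
          (morseStep_edge_iff.2 (.inl ⟨fun h => hedge i h (mem_univ i), rfl⟩))
      exact hacyc {0 + 1} (forall_of_sub_one (P := fun j => Relation.TransGen r {0 + 1} {j})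
        (step 0) (fun j hj => hj.trans (step j)) (0 + 1))
  · intro h
    refine ⟨fun p hp => ?_, isMatchingPairs_arcs_iff.2 ⟨h.edge_disjoint, h.node_disjoint⟩,
      h.not_recurrent⟩
    simp only [arcs, coe_union, coe_image, Set.mem_union, Set.mem_image] at hp
    rcases hp with ⟨i, -, rfl⟩ | ⟨i, -, rfl⟩
    · exact (hasseArc_iff _ _).2 ⟨i, rfl, .inl rfl⟩
    · exact (hasseArc_iff _ _).2 ⟨i, rfl, .inr rfl⟩

theorem Admissible.card_add_card_lt {A B : Finset (Fin (m + 3))} (h : Admissible A B) :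
    A.card + B.card < m + 3 := by
  have hdisj : Disjoint A B := disjoint_left.2 h.edge_disjoint
  have hle : (A ∪ B).card ≤ m + 3 := by simpa using card_le_univ (A ∪ B)
  rw [← card_union_of_disjoint hdisj]
  refine lt_of_le_of_ne hle fun heq => ?_
  have huniv (i) : i ∈ A ∨ i ∈ B := by
    rw [← mem_union, (card_eq_iff_eq_univ _).1 (heq.trans (Fintype.card_fin _).symm)]
    exact mem_univ i
  obtain ⟨i, hi⟩ : ∃ i, i ∉ A := by
    by_contra! hA
    exact h.left_ne_univ (eq_univ_iff_forall.2 hA)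
  refine h.right_ne_univ (eq_univ_iff_forall.2 fun j => ?_)
  exact forall_of_add_one (P := (· ∈ B)) ((huniv i).resolve_left hi)
    (fun j hj => (huniv (j + 1)).resolve_left fun hA => h.node_disjoint j hA hj) j

/-- A matching that misses at least two nodes and to which no arc can be added
covers at least a third of all arcs. -/
theorem le_of_maximal {A B : Finset (Fin (m + 3))} (h : Admissible A B)
    (hmax : ∀ A' B', Admissible A' B' → A ⊆ A' → B ⊆ B' → A' = A ∧ B' = B)
    (hcard : A.card + B.card ≤ m + 1) : 2 * (m + 3) ≤ 3 * (A.card + B.card) := by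
  have ne_univ {C : Finset (Fin (m + 3))} (hC : C.card < m + 3) : C ≠ univ := by
    rintro rfl
    simp at hC
  have hleft : (univ : Finset (Fin (m + 3))) ⊆ A ∪ (B ∪ B.image (· + 1)) := by
    intro i _
    by_contra hi
    simp only [mem_union, mem_image, not_or, not_exists, not_and] at hi
    obtain ⟨hiA, hiB, hiB'⟩ := hi
    have hA : Admissible (insert i A) B := by
      refine ⟨?_, ?_, ne_univ ?_, h.right_ne_univ⟩
      · intro j hj
        rcases mem_insert.1 hj with rfl | hj
        exacts [hiB, h.edge_disjoint j hj]
      · intro j hj hjB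
        rcases mem_insert.1 hj with hj | hj
        exacts [hiB' j hjB hj, h.node_disjoint j hj hjB]
      · rw [card_insert_of_notMem hiA]
        omega
    exact hiA ((hmax _ _ hA (subset_insert _ _) Subset.rfl).1 ▸ mem_insert_self i A)
  have hright : (univ : Finset (Fin (m + 3))) ⊆ B ∪ (A ∪ A.image (· - 1)) := by
    intro i _
    by_contra hi
    simp only [mem_union, mem_image, not_or, not_exists, not_and] at hi
    obtain ⟨hiB, hiA, hiA'⟩ := hi
    have hB : Admissible A (insert i B) := by
      refine ⟨?_, ?_, h.left_ne_univ, ne_univ ?_⟩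
      · intro j hjA hj
        rcases mem_insert.1 hj with rfl | hj
        exacts [hiA hjA, h.edge_disjoint j hjA hj]
      · intro j hjA hj
        rcases mem_insert.1 hj with rfl | hj
        exacts [hiA' _ hjA (by simp), h.node_disjoint j hjA hj]
      · rw [card_insert_of_notMem hiB]
        omega
    exact hiB ((hmax _ _ hB Subset.rfl (subset_insert _ _)).2 ▸ mem_insert_self i B)
  have bound {C D E : Finset (Fin (m + 3))} (hE : E.card ≤ D.card)
      (hC : (univ : Finset (Fin (m + 3))) ⊆ C ∪ (D ∪ E)) : m + 3 ≤ C.card + 2 * D.card := by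
    have h₁ := card_le_card hC
    have h₂ := card_union_le C (D ∪ E)
    have h₃ := card_union_le D E
    simp only [card_univ, Fintype.card_fin] at h₁
    omega
  have h₁ := bound card_image_le hleft
  have h₂ := bound card_image_le hright
  omega

/-- For cycles with at least six nodes there is a maximal Morse matching that leaves
two nodes uncovered. -/
theorem exists_maximal_card_eq (hm : 3 ≤ m) : ∃ A B : Finset (Fin (m + 3)), Admissible A B ∧
    (∀ A' B', Admissible A' B' → A ⊆ A' → B ⊆ B' → A' = A ∧ B' = B) ∧
    A.card + B.card = m + 1 := by
  let x (k : ℕ) (hk : k < 6) : Fin (m + 3) := ⟨k, by omega⟩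
  let C : Finset (Fin (m + 3)) :=
    {x 0 (by omega), x 1 (by omega), x 3 (by omega), x 4 (by omega)}
  let B : Finset (Fin (m + 3)) := {x 0 (by omega), x 3 (by omega)}
  have hC : C.card = 4 := by simp [C, x]
  have hB : B.card = 2 := by simp [B, x]
  have memA (i) : i ∈ Cᶜ ↔ i.val ≠ 0 ∧ i.val ≠ 1 ∧ i.val ≠ 3 ∧ i.val ≠ 4 := by
    simp only [C, x, mem_compl, mem_insert, mem_singleton, Fin.ext_iff, not_or, ne_eq]
  have memB (i) : i ∈ B ↔ i.val = 0 ∨ i.val = 3 := by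
    simp only [B, x, mem_insert, mem_singleton, Fin.ext_iff]
  have succ_val (i : Fin (m + 3)) : (i + 1).val = if i.val = m + 2 then 0 else i.val + 1 := by
    simp [Fin.val_add_one, Fin.ext_iff]
  refine ⟨Cᶜ, B, ⟨?_, ?_, ?_, ?_⟩, ?_, ?_⟩
  · intro i hi
    rw [memA] at hi
    rw [memB]
    omega
  · intro i hi
    rw [memA, succ_val] at hi
    rw [memB]
    split_ifs at hi <;> omega
  · intro h
    have := (memA (x 0 (by omega))).1 (h ▸ mem_univ _)
    simp [x] at this
  · intro h
    have := (memB (x 1 (by omega))).1 (h ▸ mem_univ _)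
    simp [x] at this
  · intro A' B' h hA hB
    constructor
    · refine (Subset.antisymm hA fun i hi => ?_).symm
      rw [memA]
      refine ⟨fun h0 => ?_, fun h1 => ?_, fun h3 => ?_, fun h4 => ?_⟩
      · exact h.edge_disjoint i hi (hB ((memB i).2 (.inl h0)))
      · refine h.node_disjoint (x 0 (by omega)) ?_ (hB ((memB _).2 (.inl rfl)))
        convert hi
        simp [Fin.ext_iff, x, h1]
      · exact h.edge_disjoint i hi (hB ((memB i).2 (.inr h3)))
      · refine h.node_disjoint (x 3 (by omega)) ?_ (hB ((memB _).2 (.inr rfl)))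
        convert hi
        rw [Fin.ext_iff, succ_val, if_neg (by simp only [x]; omega), h4]
    · refine (Subset.antisymm hB fun i hi => ?_).symm
      have h₁ : i ∉ Cᶜ := fun hA' => h.edge_disjoint i (hA hA') hi
      have h₂ : i + 1 ∉ Cᶜ := fun hA' => h.node_disjoint i (hA hA') hi
      rw [memA] at h₁ h₂
      rw [succ_val] at h₂
      rw [memB]
      split_ifs at h₂ <;> omega
  · rw [card_compl, Fintype.card_fin, hC, hB]
    omega

end CycleMorse

/-- for `n ≥ 3`, every inclusion-maximal Morse matching on the cycle graph
`C_n` has cardinality `n - 1` (that is, the discrete Morse complex of `C_n` is pure)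
if and only if `n ≤ 5`. -/
theorem morse_complex_cycle_pure_iff (n : ℕ) (hn : 3 ≤ n) :
    (∀ M : Finset (Finset (Fin n) × Finset (Fin n)),
        IsMorseMatching (graphComplex (SimpleGraph.cycleGraph n)) ↑M →
        (∀ M' : Finset (Finset (Fin n) × Finset (Fin n)), M ⊆ M' →
          IsMorseMatching (graphComplex (SimpleGraph.cycleGraph n)) ↑M' → M' = M) →
        M.card = n - 1) ↔ n ≤ 5 := by
  obtain ⟨m, rfl⟩ : ∃ m, n = m + 3 := ⟨n - 3, by omega⟩
  constructor
  · intro h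
    by_contra! hm
    obtain ⟨A, B, hAB, hmax, hcard⟩ := CycleMorse.exists_maximal_card_eq (m := m) (by omega)
    have := h _ (CycleMorse.isMorseMatching_arcs_iff.2 hAB) fun M' hsub hM' => by
      obtain ⟨A', B', rfl⟩ := CycleMorse.exists_eq_arcs hM'.1
      obtain ⟨hA, hB⟩ := CycleMorse.arcs_subset_iff.1 hsub
      obtain ⟨rfl, rfl⟩ := hmax A' B' (CycleMorse.isMorseMatching_arcs_iff.1 hM') hA hB
      rfl
    rw [CycleMorse.card_arcs] at this
    omega
  · intro hm M hM hmax
    obtain ⟨A, B, rfl⟩ := CycleMorse.exists_eq_arcs hM.1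
    have hAB := CycleMorse.isMorseMatching_arcs_iff.1 hM
    have hlt := hAB.card_add_card_lt
    rw [CycleMorse.card_arcs]
    by_contra hne
    have := CycleMorse.le_of_maximal hAB (fun A' B' h hA hB => by
      have heq := hmax _ (CycleMorse.arcs_subset_iff.2 ⟨hA, hB⟩)
        (CycleMorse.isMorseMatching_arcs_iff.2 h)
      obtain ⟨hA', hB'⟩ := CycleMorse.arcs_subset_iff.1 heq.subset
      exact ⟨hA'.antisymm hA, hB'.antisymm hB⟩) (by omega)
    omega
end
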